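/- arXiv:2512.08519 — 4 statements merged into one kernel-verified Lean document; each statement's English description precedes it below -/
import Mathlib

section
/- Let T : X → X be an operator. Then the following are equivalent: (1) T is topologically ergodic; (2) T is weakly disjoint from every weakly mixing operator; (3) T is weakly disjoint from every invertible weakly mixing bilateral weighted backward shift on Y, where Y = c₀(ℤ) or ℓ^p(ℤ), 1 ≤ p < ∞; (4) for every invertible weakly mixing bilateral weighted backward shift S on such Y, T ⊕ S is weakly mixing; (5) for every weakly mixing operator S : Y → Y, T ⊕ S is weakly mixing. -/
open Set Topology Function Filter
open scoped ENNReal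

/- ### Basic dynamical notions -/

/-- The return time set `N(U,V) = {n ∈ ℕ : T^n(U) ∩ V ≠ ∅}`. -/
def nset {X : Type*} (T : X → X) (U V : Set X) : Set ℕ :=
  {n : ℕ | ∃ x ∈ U, T^[n] x ∈ V}

/-- A Furstenberg family: nonempty, hereditary upward, not containing `∅`. -/
def IsFamily (F : Set (Set ℕ)) : Prop :=
  F.Nonempty ∧ (∀ ⦃A B : Set ℕ⦄, A ∈ F → A ⊆ B → B ∈ F) ∧ ∅ ∉ F

/-- `T` is `F`-transitive. -/
def FTrans {X : Type*} [TopologicalSpace X] (T : X → X) (F : Set (Set ℕ)) : Prop :=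
  ∀ U V : Set X, IsOpen U → IsOpen V → U.Nonempty → V.Nonempty → nset T U V ∈ F

/-- Direct sum (product) of two maps. -/
def prodMap' {X Y : Type*} (T : X → X) (S : Y → Y) : X × Y → X × Y :=
  fun p => (T p.1, S p.2)

/-- `T` is `F`-mixing: `T × T` is `F`-transitive. -/
def FMix {X : Type*} [TopologicalSpace X] (T : X → X) (F : Set (Set ℕ)) : Prop :=
  FTrans (prodMap' T T) F

/-- Topological transitivity. -/
def TopTrans {X : Type*} [TopologicalSpace X] (T : X → X) : Prop :=
  ∀ U V : Set X, IsOpen U → IsOpen V → U.Nonempty → V.Nonempty → (nset T U V).Nonempty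

/-- Weak mixing: `T × T` is topologically transitive. -/
def WMix {X : Type*} [TopologicalSpace X] (T : X → X) : Prop :=
  TopTrans (prodMap' T T)

/-- Hypercyclicity: some point has dense orbit. -/
def HypercyclicMap {X : Type*} [TopologicalSpace X] (T : X → X) : Prop :=
  ∃ x : X, Dense (Set.range fun n : ℕ => T^[n] x)

/-- Weak disjointness: the direct sum is hypercyclic. -/
def WeaklyDisjoint {X Y : Type*} [TopologicalSpace X] [TopologicalSpace Y]
    (T : X → X) (S : Y → Y) : Prop :=
  HypercyclicMap (prodMap' T S)

/-- The family generated by the return time sets of `T`. -/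
def NTfam {X : Type*} [TopologicalSpace X] (T : X → X) : Set (Set ℕ) :=
  {A : Set ℕ | ∃ U V : Set X, IsOpen U ∧ IsOpen V ∧ U.Nonempty ∧ V.Nonempty ∧ nset T U V ⊆ A}

/- ### Combinatorial families -/

/-- `(A + i) ∩ ℕ` for `i : ℤ`. -/
def shiftSet (A : Set ℕ) (i : ℤ) : Set ℕ := {n : ℕ | ∃ m ∈ A, (n : ℤ) = (m : ℤ) + i}

/-- A shift-invariant family. -/
def ShiftInvariant (F : Set (Set ℕ)) : Prop := ∀ A ∈ F, ∀ i : ℤ, shiftSet A i ∈ F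

/-- A shift₊-invariant family: `A + i ∈ F` for `i : ℕ`. -/
def ShiftPlusInvariant (F : Set (Set ℕ)) : Prop :=
  ∀ A ∈ F, ∀ i : ℕ, (fun n => n + i) '' A ∈ F

/-- A thick family: `⋂_{i=0}^{k} ((A - i) ∩ ℕ) ∈ F` for all `A ∈ F`, `k ∈ ℕ`. -/
def ThickFamily (F : Set (Set ℕ)) : Prop :=
  ∀ A ∈ F, ∀ k : ℕ, {n : ℕ | ∀ i ≤ k, n + i ∈ A} ∈ F

/-- The dual family `F*`. -/
def dualFam (F : Set (Set ℕ)) : Set (Set ℕ) := {A | ∀ B ∈ F, (A ∩ B).Nonempty}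

/-- A full family. -/
def FullFamily (F : Set (Set ℕ)) : Prop :=
  ∀ A ∈ F, ∀ B ∈ dualFam F, (A ∩ B).Infinite

/-- `F̃`: the members `A` of `F` with `⋂_{i=-k}^{k} ((A + i) ∩ ℕ) ∈ F` for all `k ∈ ℕ`. -/
def tildeFam (F : Set (Set ℕ)) : Set (Set ℕ) :=
  {A ∈ F | ∀ k : ℕ, {n : ℕ | ∀ i : ℤ, |i| ≤ (k : ℤ) → n ∈ shiftSet A i} ∈ F}

/-- A thick subset of `ℕ`: contains arbitrarily long blocks of consecutive integers. -/
def IsThickSet (A : Set ℕ) : Prop := ∀ k : ℕ, ∃ n : ℕ, ∀ i ≤ k, n + i ∈ A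

/-- A syndetic subset of `ℕ` (bounded gaps). -/
def IsSyndetic (A : Set ℕ) : Prop := ∃ g : ℕ, ∀ n : ℕ, ∃ m ∈ A, n ≤ m ∧ m ≤ n + g

/-- A piecewise syndetic subset: intersection of a syndetic and a thick set. -/
def IsPiecewiseSyndetic (A : Set ℕ) : Prop :=
  ∃ S T : Set ℕ, IsSyndetic S ∧ IsThickSet T ∧ A = S ∩ T

/-- An IP-set. -/
def IsIPSet (A : Set ℕ) : Prop :=
  ∃ x : ℕ → ℕ, {n | x n ≠ 0}.Infinite ∧ ∀ s : Finset ℕ, s.Nonempty → (∑ i ∈ s, x i) ∈ A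

/-- `(A - A) ∩ ℕ` for `A ⊆ ℕ`: positive differences of distinct elements. -/
def diffSet (A : Set ℕ) : Set ℕ := {k | ∃ m ∈ A, ∃ n ∈ A, n < m ∧ k = m - n}

/-- The family `Δ*_ip`. -/
def deltaIPStar : Set (Set ℕ) :=
  {A | ∀ F : Set ℕ, IsIPSet F → (A ∩ diffSet F).Nonempty}

/- ### Operators on Fréchet spaces -/

/-- A (continuous linear) operator on an infinite-dimensional separable Fréchet space
(a complete metrizable locally convex topological vector space) over `ℝ` or `ℂ`
(an `RCLike` field). -/
structure FrechetOp where
  𝕜 : Type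
  [instField : RCLike 𝕜]
  X : Type
  [instAdd : AddCommGroup X]
  [instMod : Module 𝕜 X]
  [instUnif : UniformSpace X]
  [instUAG : IsUniformAddGroup X]
  [instSMul : ContinuousSMul 𝕜 X]
  [instComplete : CompleteSpace X]
  [instMetrizable : TopologicalSpace.MetrizableSpace X]
  [instSeparable : TopologicalSpace.SeparableSpace X]
  [instModR : Module ℝ X]
  [instTower : IsScalarTower ℝ 𝕜 X]
  [instLC : LocallyConvexSpace ℝ X]
  infDim : ¬ FiniteDimensional 𝕜 X
  T : X → X
  linear : IsLinearMap 𝕜 T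
  cont : Continuous T

attribute [instance] FrechetOp.instAdd FrechetOp.instMod
  FrechetOp.instUnif FrechetOp.instUAG FrechetOp.instSMul FrechetOp.instComplete
  FrechetOp.instMetrizable FrechetOp.instSeparable FrechetOp.instModR
  FrechetOp.instTower FrechetOp.instLC

/-- A bundled Fréchet-space operator is hypercyclic. -/
def FrechetOp.Hypercyclic (S : FrechetOp) : Prop := HypercyclicMap S.T

/-- A bundled Fréchet-space operator is invertible (a linear homeomorphism). -/
def FrechetOp.Invertible (S : FrechetOp) : Prop :=
  ∃ T' : S.X → S.X, Continuous T' ∧ (∀ x, T' (S.T x) = x) ∧ (∀ x, S.T (T' x) = x)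

/-- Mild mixing: weakly disjoint from every hypercyclic operator
(on every infinite-dimensional separable Fréchet space). -/
def MildlyMixing {X : Type*} [TopologicalSpace X] (T : X → X) : Prop :=
  ∀ S : FrechetOp, S.Hypercyclic → WeaklyDisjoint T S.T

/-- Topological ergodicity: all return time sets are syndetic. -/
def TopErgodic {X : Type*} [TopologicalSpace X] (T : X → X) : Prop :=
  ∀ U V : Set X, IsOpen U → IsOpen V → U.Nonempty → V.Nonempty → IsSyndetic (nset T U V)

/-- The `F`-Mixing Criterion for a map `T`. -/
def FMixCriterion {X : Type*} [TopologicalSpace X] [Zero X] (T : X → X)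
    (F : Set (Set ℕ)) : Prop :=
  ∃ X₀ Y₀ : Set X, Dense X₀ ∧ Dense Y₀ ∧ ∃ S : ℕ → X → X,
    ∀ x₀ ∈ X₀, ∀ y₀ ∈ Y₀, ∀ O ∈ nhds ((0, 0, y₀) : X × X × X),
      {n : ℕ | (T^[n] x₀, S n y₀, T^[n] (S n y₀)) ∈ O} ∈ F

/- ### Bilateral weighted backward shifts on `ℓᵖ(ℤ)` and `c₀(ℤ)` -/

/-- `B` is the bilateral weighted backward shift with (positive, bounded) weight `w` on
`ℓᵖ(ℤ)`; the condition that `1/w` is bounded makes it invertible. -/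
def IsInvertibleWBSlp (𝕜 : Type) [RCLike 𝕜] (p : ℝ≥0∞) [Fact (1 ≤ p)] (w : ℤ → ℝ)
    (B : lp (fun _ : ℤ => 𝕜) p →L[𝕜] lp (fun _ : ℤ => 𝕜) p) : Prop :=
  (∀ n, 0 < w n) ∧ (∃ C : ℝ, ∀ n, w n ≤ C) ∧ (∃ c : ℝ, 0 < c ∧ ∀ n, c ≤ w n) ∧
    ∀ (x : lp (fun _ : ℤ => 𝕜) p) (n : ℤ), B x n = w (n + 1) • x (n + 1)

/-- `B` is the bilateral weighted backward shift with (positive, bounded) weight `w` on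
`c₀(ℤ)`; the condition that `1/w` is bounded makes it invertible. -/
def IsInvertibleWBSc0 (𝕜 : Type) [RCLike 𝕜] (w : ℤ → ℝ)
    (B : ZeroAtInftyContinuousMap ℤ 𝕜 →L[𝕜] ZeroAtInftyContinuousMap ℤ 𝕜) : Prop :=
  (∀ n, 0 < w n) ∧ (∃ C : ℝ, ∀ n, w n ≤ C) ∧ (∃ c : ℝ, 0 < c ∧ ∀ n, c ≤ w n) ∧
    ∀ (x : ZeroAtInftyContinuousMap ℤ 𝕜) (n : ℤ), B x n = w (n + 1) • x (n + 1)

/- ### Abstract dynamics -/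

lemma prodMap'_iterate {X Y : Type*} (T : X → X) (S : Y → Y) (n : ℕ) (p : X × Y) :
    (prodMap' T S)^[n] p = (T^[n] p.1, S^[n] p.2) := by
  induction n generalizing p with
  | zero => rfl
  | succ n ih => rw [iterate_succ_apply, ih]; rfl

lemma topTrans_prod_of_boxes {X Y : Type*} [TopologicalSpace X] [TopologicalSpace Y]
    {T : X → X} {S : Y → Y}
    (h : ∀ (U V : Set X) (U' V' : Set Y), IsOpen U → IsOpen V → IsOpen U' → IsOpen V' →
      U.Nonempty → V.Nonempty → U'.Nonempty → V'.Nonempty →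
      ∃ n, n ∈ nset T U V ∧ n ∈ nset S U' V') : TopTrans (prodMap' T S) := by
  rintro A B hA hB ⟨⟨a, a'⟩, ha⟩ ⟨⟨b, b'⟩, hb⟩
  obtain ⟨U, U', hU, hU', hau, hau', hUA⟩ := isOpen_prod_iff.1 hA a a' ha
  obtain ⟨V, V', hV, hV', hbv, hbv', hVB⟩ := isOpen_prod_iff.1 hB b b' hb
  obtain ⟨n, ⟨x, hx, hx'⟩, ⟨y, hy, hy'⟩⟩ :=
    h U V U' V' hU hV hU' hV' ⟨a, hau⟩ ⟨b, hbv⟩ ⟨a', hau'⟩ ⟨b', hbv'⟩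
  refine ⟨n, (x, y), hUA ⟨hx, hy⟩, ?_⟩
  rw [prodMap'_iterate]
  exact hVB ⟨hx', hy'⟩

lemma boxes_of_topTrans_prod {X Y : Type*} [TopologicalSpace X] [TopologicalSpace Y]
    {T : X → X} {S : Y → Y} (h : TopTrans (prodMap' T S))
    (U V : Set X) (U' V' : Set Y) (hU : IsOpen U) (hV : IsOpen V) (hU' : IsOpen U')
    (hV' : IsOpen V') (nU : U.Nonempty) (nV : V.Nonempty) (nU' : U'.Nonempty)
    (nV' : V'.Nonempty) : ∃ n, n ∈ nset T U V ∧ n ∈ nset S U' V' := by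
  obtain ⟨n, p, hp, hp'⟩ := h (U ×ˢ U') (V ×ˢ V') (hU.prod hU') (hV.prod hV')
    (nU.prod nU') (nV.prod nV')
  rw [prodMap'_iterate] at hp'
  exact ⟨n, ⟨p.1, hp.1, hp'.1⟩, ⟨p.2, hp.2, hp'.2⟩⟩

/-- Furstenberg's intersection lemma. -/
lemma furstenberg {X : Type*} [TopologicalSpace X] {T : X → X} (hc : Continuous T)
    (h : WMix T) (U₁ V₁ U₂ V₂ : Set X) (hU₁ : IsOpen U₁) (hV₁ : IsOpen V₁)
    (hU₂ : IsOpen U₂) (hV₂ : IsOpen V₂) (nU₁ : U₁.Nonempty) (nV₁ : V₁.Nonempty)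
    (nU₂ : U₂.Nonempty) (nV₂ : V₂.Nonempty) :
    ∃ U V : Set X, IsOpen U ∧ IsOpen V ∧ U.Nonempty ∧ V.Nonempty ∧
      nset T U V ⊆ nset T U₁ V₁ ∩ nset T U₂ V₂ := by
  obtain ⟨n, ⟨x, hx, hx'⟩, ⟨y, hy, hy'⟩⟩ := boxes_of_topTrans_prod h U₁ U₂ V₁ V₂
    hU₁ hU₂ hV₁ hV₂ nU₁ nU₂ nV₁ nV₂
  refine ⟨U₁ ∩ T^[n] ⁻¹' U₂, V₁ ∩ T^[n] ⁻¹' V₂, hU₁.inter (hU₂.preimage (hc.iterate n)),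
    hV₁.inter (hV₂.preimage (hc.iterate n)), ⟨x, hx, hx'⟩, ⟨y, hy, hy'⟩, ?_⟩
  rintro k ⟨z, ⟨hz, hz'⟩, hz₁, hz₂⟩
  refine ⟨⟨z, hz, hz₁⟩, ⟨T^[n] z, hz', ?_⟩⟩
  have : T^[k] (T^[n] z) = T^[n] (T^[k] z) := by
    rw [← iterate_add_apply, ← iterate_add_apply, add_comm]
  rw [this]; exact hz₂

lemma preimage_nonempty {Y : Type*} [TopologicalSpace Y] [T2Space Y]
    [hp : ∀ y : Y, NeBot (𝓝[≠] y)] {S : Y → Y} (hc : Continuous S)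
    (h : WMix S) (i : ℕ) (V : Set Y) (hV : IsOpen V) (nV : V.Nonempty) :
    (S^[i] ⁻¹' V).Nonempty := by
  induction i generalizing V with
  | zero => exact nV
  | succ i ih =>
    have key : (S ⁻¹' V).Nonempty := by
      obtain ⟨v, hv⟩ := nV
      obtain ⟨u, hu, huv⟩ : ∃ u ∈ V, u ≠ v := by
        have := (hp v).nonempty_of_mem
          (inter_mem (mem_nhdsWithin_of_mem_nhds (hV.mem_nhds hv)) self_mem_nhdsWithin)
        obtain ⟨u, hu, hu'⟩ := this
        exact ⟨u, hu, hu'⟩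
      obtain ⟨A, B, hA, hB, huA, hvB, hAB⟩ := t2_separation huv
      obtain ⟨n, -, ⟨x, hx, hx'⟩⟩ := boxes_of_topTrans_prod h (A ∩ V) (B ∩ V) (A ∩ V) (B ∩ V)
        (hA.inter hV) (hB.inter hV) (hA.inter hV) (hB.inter hV) ⟨u, huA, hu⟩ ⟨v, hvB, hv⟩
        ⟨u, huA, hu⟩ ⟨v, hvB, hv⟩
      cases n with
      | zero => exact absurd hx'.1 (disjoint_left.1 hAB hx.1)
      | succ n =>
        rw [iterate_succ_apply'] at hx'
        exact ⟨_, hx'.2⟩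
    have := ih (S ⁻¹' V) (hV.preimage hc) key
    rw [iterate_succ']
    exact this

lemma wmix_thick {Y : Type*} [TopologicalSpace Y] [T2Space Y]
    [hp : ∀ y : Y, NeBot (𝓝[≠] y)] {S : Y → Y} (hc : Continuous S)
    (h : WMix S) (U V : Set Y) (hU : IsOpen U) (hV : IsOpen V) (nU : U.Nonempty)
    (nV : V.Nonempty) (k : ℕ) : ∃ n, ∀ i ≤ k, n + i ∈ nset S U V := by
  have key : ∃ U' V' : Set Y, IsOpen U' ∧ IsOpen V' ∧ U'.Nonempty ∧ V'.Nonempty ∧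
      ∀ n ∈ nset S U' V', ∀ i ≤ k, n + i ∈ nset S U V := by
    induction k with
    | zero => exact ⟨U, V, hU, hV, nU, nV, fun n hn i hi => by
        obtain rfl : i = 0 := by omega
        exact hn⟩
    | succ k ih =>
      obtain ⟨U', V', hU', hV', nU', nV', h'⟩ := ih
      obtain ⟨U'', V'', hU'', hV'', nU'', nV'', h''⟩ := furstenberg hc h U' V' U
        (S^[k+1] ⁻¹' V) hU' hV' hU (hV.preimage (hc.iterate _)) nU' nV' nU
        (preimage_nonempty hc h _ V hV nV)
      refine ⟨U'', V'', hU'', hV'', nU'', nV'', fun n hn i hi => ?_⟩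
      rcases Nat.lt_or_ge k i with hki | hki
      · obtain rfl : i = k + 1 := by omega
        obtain ⟨x, hx, hx'⟩ := (h'' hn).2
        refine ⟨x, hx, ?_⟩
        rw [add_comm, iterate_add_apply]
        exact hx'
      · exact h' n (h'' hn).1 i hki
  obtain ⟨U', V', hU', hV', nU', nV', h'⟩ := key
  obtain ⟨n, hn, -⟩ := boxes_of_topTrans_prod h U' V' U' V' hU' hV' hU' hV' nU' nV' nU' nV'
  exact ⟨n, h' n hn⟩

section erg
variable {X : Type*} [AddCommGroup X] [TopologicalSpace X] [IsTopologicalAddGroup X]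

lemma iter_add {T : X → X} (ha : ∀ x y, T (x + y) = T x + T y) (n : ℕ) (x y : X) :
    T^[n] (x + y) = T^[n] x + T^[n] y := by
  induction n with
  | zero => rfl
  | succ n ih => simp only [iterate_succ_apply', ih, ha]

lemma iter_zero {T : X → X} (ha : ∀ x y, T (x + y) = T x + T y) (n : ℕ) :
    T^[n] 0 = 0 := by
  have := iter_add ha n 0 0
  simpa using this

lemma erg_three {T : X → X} (hc : Continuous T) (ha : ∀ x y, T (x + y) = T x + T y)
    (h : TopErgodic T) (U V W : Set X) (hU : IsOpen U) (hV : IsOpen V) (hW : IsOpen W)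
    (nU : U.Nonempty) (nV : V.Nonempty) (hW0 : (0 : X) ∈ W) :
    ∃ n, n ∈ nset T U W ∧ n ∈ nset T W V := by
  obtain ⟨g, hg⟩ := h W V hW hV ⟨0, hW0⟩ nV
  let W' : Set X := ⋂ i ∈ Finset.range (g + 1), T^[i] ⁻¹' W
  have hW' : IsOpen W' := isOpen_biInter_finset fun i _ => hW.preimage (hc.iterate i)
  have h0 : (0 : X) ∈ W' := by
    simp only [W', mem_iInter, mem_preimage]
    intro i _
    rw [iter_zero ha]; exact hW0
  obtain ⟨g', hg'⟩ := h U W' hU hW' nU ⟨0, h0⟩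
  obtain ⟨n, ⟨x, hx, hx'⟩, -⟩ := hg' 0
  obtain ⟨m, hm, hnm, hmn⟩ := hg n
  refine ⟨m, ⟨x, hx, ?_⟩, hm⟩
  obtain ⟨i, rfl⟩ := Nat.exists_eq_add_of_le hnm
  simp only [W', mem_iInter, mem_preimage] at hx'
  have := hx' i (Finset.mem_range.2 (by omega))
  rwa [add_comm, iterate_add_apply]

lemma exists_add_nhds {U : Set X} (hU : IsOpen U) {u : X} (hu : u ∈ U) :
    ∃ A W : Set X, IsOpen A ∧ IsOpen W ∧ u ∈ A ∧ (0 : X) ∈ W ∧ ∀ a ∈ A, ∀ w ∈ W, a + w ∈ U := by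
  have : IsOpen ((fun p : X × X => p.1 + p.2) ⁻¹' U) := hU.preimage continuous_add
  obtain ⟨A, W, hA, hW, h1, h2, h3⟩ := isOpen_prod_iff.1 this u 0 (by simpa using hu)
  exact ⟨A, W, hA, hW, h1, h2, fun a ha w hw => h3 (mk_mem_prod ha hw)⟩

lemma erg_wmix {T : X → X} (hc : Continuous T) (ha : ∀ x y, T (x + y) = T x + T y)
    (h : TopErgodic T) : WMix T := by
  apply topTrans_prod_of_boxes
  rintro U₁ V₁ U₂ V₂ hU₁ hV₁ hU₂ hV₂ ⟨u₁, nU₁⟩ ⟨v₁, nV₁⟩ ⟨u₂, nU₂⟩ ⟨v₂, nV₂⟩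
  obtain ⟨A₁, W₁, oA₁, oW₁, hA₁, hW₁, k₁⟩ := exists_add_nhds hU₁ nU₁
  obtain ⟨A₂, W₂, oA₂, oW₂, hA₂, hW₂, k₂⟩ := exists_add_nhds hU₂ nU₂
  obtain ⟨A₃, W₃, oA₃, oW₃, hA₃, hW₃, k₃⟩ := exists_add_nhds hV₁ nV₁
  obtain ⟨A₄, W₄, oA₄, oW₄, hA₄, hW₄, k₄⟩ := exists_add_nhds hV₂ nV₂
  let W := (W₁ ∩ W₂) ∩ (W₃ ∩ W₄)
  have oW : IsOpen W := (oW₁.inter oW₂).inter (oW₃.inter oW₄)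
  have hW : (0 : X) ∈ W := ⟨⟨hW₁, hW₂⟩, hW₃, hW₄⟩
  obtain ⟨g, hg⟩ := h A₁ A₂ oA₁ oA₂ ⟨_, hA₁⟩ ⟨_, hA₂⟩
  obtain ⟨m, ⟨a, ham, ham'⟩, -⟩ := hg 0
  obtain ⟨g', hg'⟩ := h A₃ A₄ oA₃ oA₄ ⟨_, hA₃⟩ ⟨_, hA₄⟩
  obtain ⟨l, ⟨b, hbm, hbm'⟩, -⟩ := hg' 0
  let W' := W ∩ (T^[m] ⁻¹' W ∩ T^[l] ⁻¹' W)
  have oW' : IsOpen W' :=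
    oW.inter ((oW.preimage (hc.iterate _)).inter (oW.preimage (hc.iterate _)))
  have hW' : (0 : X) ∈ W' := ⟨hW, by simpa [iter_zero ha] using hW, by
    simpa [iter_zero ha] using hW⟩
  obtain ⟨n, ⟨x, ⟨hx, hxm⟩, hx'⟩, ⟨y, hy, ⟨hy', hyl⟩⟩⟩ := erg_three hc ha h
    (A₁ ∩ T^[m] ⁻¹' A₂) (A₃ ∩ T^[l] ⁻¹' A₄) W'
    (oA₁.inter (oA₂.preimage (hc.iterate _))) (oA₃.inter (oA₄.preimage (hc.iterate _))) oW'
    ⟨a, ham, ham'⟩ ⟨b, hbm, hbm'⟩ hW'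
  have comm : ∀ (i j : ℕ) (z : X), T^[i] (T^[j] z) = T^[j] (T^[i] z) := fun i j z => by
    rw [← iterate_add_apply, ← iterate_add_apply, add_comm]
  refine ⟨n, ⟨x + y, k₁ _ hx _ hy.1.1.1, ?_⟩, ⟨T^[m] x + T^[l] y, k₂ _ hxm _ hy.2.2.1.2, ?_⟩⟩
  · rw [iter_add ha, add_comm]
    exact k₃ _ hy' _ hx'.1.2.1
  · rw [iter_add ha, add_comm, comm n l, comm n m]
    exact k₄ _ hyl _ hx'.2.1.2.2

lemma erg_prod_wmix {Y : Type*} [TopologicalSpace Y] [T2Space Y]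
    [hp : ∀ y : Y, NeBot (𝓝[≠] y)] {T : X → X} (hc : Continuous T)
    (ha : ∀ x y, T (x + y) = T x + T y) (h : TopErgodic T) {S : Y → Y} (hS : Continuous S)
    (hw : WMix S) : WMix (prodMap' T S) := by
  have hwT := erg_wmix hc ha h
  rintro A B hA hB ⟨⟨⟨a₁, a₂⟩, a₃, a₄⟩, hmA⟩ ⟨⟨⟨b₁, b₂⟩, b₃, b₄⟩, hmB⟩
  have box : ∀ (A : Set ((X × Y) × (X × Y))) (_ : IsOpen A) (a₁ a₃ : X) (a₂ a₄ : Y)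
      (_ : ((a₁, a₂), (a₃, a₄)) ∈ A), ∃ (U₁ U₃ : Set X) (U₂ U₄ : Set Y), IsOpen U₁ ∧ IsOpen U₃ ∧
      IsOpen U₂ ∧ IsOpen U₄ ∧ a₁ ∈ U₁ ∧ a₃ ∈ U₃ ∧ a₂ ∈ U₂ ∧ a₄ ∈ U₄ ∧
      (U₁ ×ˢ U₂) ×ˢ (U₃ ×ˢ U₄) ⊆ A := by
    intro A hA a₁ a₃ a₂ a₄ hm
    obtain ⟨P, Q, oP, oQ, hP, hQ, hPQ⟩ := isOpen_prod_iff.1 hA _ _ hm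
    obtain ⟨U₁, U₂, o1, o2, h1, h2, h12⟩ := isOpen_prod_iff.1 oP _ _ hP
    obtain ⟨U₃, U₄, o3, o4, h3, h4, h34⟩ := isOpen_prod_iff.1 oQ _ _ hQ
    exact ⟨U₁, U₃, U₂, U₄, o1, o3, o2, o4, h1, h3, h2, h4,
      (prod_mono h12 h34).trans hPQ⟩
  obtain ⟨U₁, U₃, U₂, U₄, oU₁, oU₃, oU₂, oU₄, m₁, m₃, m₂, m₄, hU⟩ := box A hA _ _ _ _ hmA
  obtain ⟨V₁, V₃, V₂, V₄, oV₁, oV₃, oV₂, oV₄, l₁, l₃, l₂, l₄, hV⟩ := box B hB _ _ _ _ hmB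
  obtain ⟨P, Q, oP, oQ, nP, nQ, hPQ⟩ := furstenberg hc hwT U₁ V₁ U₃ V₃ oU₁ oV₁ oU₃ oV₃
    ⟨_, m₁⟩ ⟨_, l₁⟩ ⟨_, m₃⟩ ⟨_, l₃⟩
  obtain ⟨P', Q', oP', oQ', nP', nQ', hPQ'⟩ := furstenberg hS hw U₂ V₂ U₄ V₄ oU₂ oV₂ oU₄ oV₄
    ⟨_, m₂⟩ ⟨_, l₂⟩ ⟨_, m₄⟩ ⟨_, l₄⟩
  obtain ⟨g, hg⟩ := h P Q oP oQ nP nQ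
  obtain ⟨n, hn⟩ := wmix_thick hS hw P' Q' oP' oQ' nP' nQ' g
  obtain ⟨k, hk, hnk, hkn⟩ := hg n
  obtain ⟨i, rfl⟩ := Nat.exists_eq_add_of_le hnk
  obtain ⟨⟨x₁, hx₁, hx₁'⟩, ⟨x₃, hx₃, hx₃'⟩⟩ := hPQ hk
  obtain ⟨⟨x₂, hx₂, hx₂'⟩, ⟨x₄, hx₄, hx₄'⟩⟩ := hPQ' (hn i (by omega))
  refine ⟨n + i, ((x₁, x₂), (x₃, x₄)), hU ⟨⟨hx₁, hx₂⟩, hx₃, hx₄⟩, hV ?_⟩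
  simp only [prodMap'_iterate]
  exact ⟨⟨hx₁', hx₂'⟩, hx₃', hx₄'⟩

end erg

lemma WMix.topTrans {X : Type*} [TopologicalSpace X] {T : X → X} (h : WMix T) : TopTrans T := by
  intro U V hU hV nU nV
  obtain ⟨n, hn, -⟩ := boxes_of_topTrans_prod h U V U V hU hV hU hV nU nV nU nV
  exact ⟨n, hn⟩

/-- Birkhoff transitivity theorem. -/
lemma TopTrans.hypercyclic {X : Type*} [TopologicalSpace X] [SecondCountableTopology X]
    [BaireSpace X] [Nonempty X] {T : X → X} (hc : Continuous T) (h : TopTrans T) :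
    HypercyclicMap T := by
  have hb := TopologicalSpace.isBasis_countableBasis X
  have hd : Dense (⋂ V ∈ TopologicalSpace.countableBasis X, ⋃ n : ℕ, T^[n] ⁻¹' V) := by
    apply dense_biInter_of_isOpen
    · intro V hV
      exact isOpen_iUnion fun n => (hb.isOpen hV).preimage (hc.iterate n)
    · exact TopologicalSpace.countable_countableBasis X
    · intro V hV
      rw [dense_iff_inter_open]
      intro U hU nU
      obtain ⟨n, x, hx, hx'⟩ := h U V hU (hb.isOpen hV) nU
        (TopologicalSpace.nonempty_of_mem_countableBasis hV)
      exact ⟨x, hx, mem_iUnion.2 ⟨n, hx'⟩⟩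
  obtain ⟨x, hx⟩ := hd.nonempty
  refine ⟨x, ?_⟩
  rw [hb.dense_iff]
  intro V hV _
  simp only [mem_iInter, mem_iUnion] at hx
  obtain ⟨n, hn⟩ := hx V hV
  exact ⟨_, hn, n, rfl⟩

lemma HypercyclicMap.topTrans {X : Type*} [TopologicalSpace X] [T1Space X]
    [hp : ∀ y : X, NeBot (𝓝[≠] y)] {T : X → X} (h : HypercyclicMap T) :
    TopTrans T := by
  obtain ⟨x, hx⟩ := h
  intro U V hU hV nU nV
  obtain ⟨_, hU', m, rfl⟩ := hx.inter_open_nonempty U hU nU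
  have hd := hx.sdiff_finite ((Finset.range m).finite_toSet.image (fun n : ℕ => T^[n] x))
  obtain ⟨_, hV', ⟨n, rfl⟩, hn⟩ := hd.inter_open_nonempty V hV nV
  have hmn : m ≤ n := by
    by_contra hlt
    exact hn ⟨n, by simpa using hlt, rfl⟩
  refine ⟨n - m, T^[m] x, hU', ?_⟩
  rw [← iterate_add_apply, Nat.sub_add_cancel hmn]
  exact hV'

/- ### The space `c₀(ℤ)` -/

abbrev C0 (𝕜 : Type) [RCLike 𝕜] := ZeroAtInftyContinuousMap ℤ 𝕜

section c0
variable {𝕜 : Type} [RCLike 𝕜]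

lemma c0_tendsto (x : C0 𝕜) : Tendsto (fun n => x n) cofinite (𝓝 0) := by
  have := x.zero_at_infty'
  rw [Filter.cocompact_eq_cofinite] at this
  exact this

noncomputable def c0mk (f : ℤ → 𝕜) (hf : Tendsto f cofinite (𝓝 0)) : C0 𝕜 where
  toFun := f
  continuous_toFun := continuous_of_discreteTopology
  zero_at_infty' := by
    rw [Filter.cocompact_eq_cofinite]; exact hf

@[simp] lemma c0mk_apply (f : ℤ → 𝕜) (hf : Tendsto f cofinite (𝓝 0)) (n : ℤ) :
    c0mk f hf n = f n := rfl

lemma tendsto_of_finite {f : ℤ → 𝕜} (hf : f.support.Finite) : Tendsto f cofinite (𝓝 0) := by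
  refine tendsto_const_nhds.congr' ?_
  have : ∀ᶠ n in cofinite, n ∉ f.support := by
    rw [Filter.eventually_cofinite]
    simpa only [not_not] using! hf
  filter_upwards [this] with n hn
  simpa [eq_comm] using hn

lemma c0_norm_le (x : C0 𝕜) {C : ℝ} (hC : 0 ≤ C) (h : ∀ n, ‖x n‖ ≤ C) : ‖x‖ ≤ C := by
  rw [← ZeroAtInftyContinuousMap.norm_toBCF_eq_norm]
  exact (BoundedContinuousFunction.norm_le hC).2 h

lemma c0_le_norm (x : C0 𝕜) (n : ℤ) : ‖x n‖ ≤ ‖x‖ := by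
  rw [← ZeroAtInftyContinuousMap.norm_toBCF_eq_norm]
  exact x.toBCF.norm_coe_le_norm n

noncomputable def c0e (i : ℤ) : C0 𝕜 :=
  c0mk (Pi.single i 1) (tendsto_of_finite
    ((Set.finite_singleton i).subset (Pi.support_single_subset)))

lemma c0e_self (i : ℤ) : (c0e i : C0 𝕜) i = 1 := by simp [c0e]

lemma c0e_ne {i j : ℤ} (h : j ≠ i) : (c0e i : C0 𝕜) j = 0 := by simp [c0e, h]

/-- Finitely supported vectors are dense. -/
lemma c0_dense_fin (x : C0 𝕜) {ε : ℝ} (hε : 0 < ε) :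
    ∃ y : C0 𝕜, (∃ s : Finset ℤ, ∀ n ∉ s, y n = 0) ∧ ‖y - x‖ ≤ ε := by
  classical
  have h := (c0_tendsto x).norm
  rw [norm_zero] at h
  have h2 : {n | ¬ ‖x n‖ < ε}.Finite := Filter.eventually_cofinite.1 (h.eventually_lt_const hε)
  let s := h2.toFinset
  refine ⟨c0mk (fun n => if n ∈ s then x n else 0) (tendsto_of_finite (s.finite_toSet.subset ?_)),
    ⟨s, fun n hn => by simp [hn]⟩, ?_⟩
  · intro n hn
    by_contra hns
    exact hn (if_neg hns)
  · apply c0_norm_le _ hε.le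
    intro n
    by_cases hn : n ∈ s
    · simp [hn, hε.le]
    · have : ‖x n‖ < ε := by simpa [s] using hn
      simp [hn, this.le]

instance c0_sep : TopologicalSpace.SeparableSpace (C0 𝕜) := by
  have h1 : TopologicalSpace.IsSeparable (Set.range (c0e : ℤ → C0 𝕜)) :=
    (Set.countable_range _).isSeparable
  have h2 := (h1.span (R := 𝕜)).closure
  rw [← TopologicalSpace.isSeparable_univ_iff]
  refine h2.mono fun x _ => ?_
  rw [Metric.mem_closure_iff]
  intro ε hε
  obtain ⟨y, ⟨s, hs⟩, hy⟩ := c0_dense_fin x (half_pos hε)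
  refine ⟨y, ?_, ?_⟩
  · have : y = ∑ i ∈ s, y i • c0e i := by
      ext n
      have hsum : (∑ i ∈ s, y i • (c0e i : C0 𝕜)) n = ∑ i ∈ s, y i * (c0e i : C0 𝕜) n := by
        let L : C0 𝕜 →+ 𝕜 := ⟨⟨fun x => x n, rfl⟩, fun _ _ => rfl⟩
        exact map_sum L (fun i => y i • (c0e i : C0 𝕜)) s
      rw [hsum]
      by_cases hn : n ∈ s
      · rw [Finset.sum_eq_single_of_mem n hn, c0e_self, mul_one]
        intro j _ hj
        rw [c0e_ne hj.symm, mul_zero]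
      · rw [hs n hn, Finset.sum_eq_zero]
        intro j hj
        rw [c0e_ne, mul_zero]
        rintro rfl
        exact hn hj
    rw [this]
    exact Submodule.sum_mem _ fun i _ => Submodule.smul_mem _ _ (Submodule.subset_span ⟨i, rfl⟩)
  · rw [dist_comm, dist_eq_norm]
    linarith

instance c0_nontriv : Nontrivial (C0 𝕜) := ⟨⟨c0e 0, 0, fun h => by
  have := DFunLike.congr_fun h 0
  rw [c0e_self] at this
  simp at this⟩⟩

lemma c0_infDim : ¬ FiniteDimensional 𝕜 (C0 𝕜) := by
  intro h
  have hli : LinearIndependent 𝕜 (c0e : ℤ → C0 𝕜) := by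
    have h1 : LinearIndependent 𝕜 (fun i : ℤ => (Pi.single i 1 : ℤ → 𝕜)) :=
      Pi.linearIndependent_single_one ℤ 𝕜
    let L : C0 𝕜 →ₗ[𝕜] (ℤ → 𝕜) := ⟨⟨fun x => x, fun _ _ => rfl⟩, fun _ _ => rfl⟩
    exact LinearIndependent.of_comp L h1
  exact Set.infinite_univ (α := ℤ) (by
    have := hli.finite
    exact Set.finite_univ)

end c0

instance lp_sep {𝕜 : Type} [RCLike 𝕜] (p : ℝ≥0∞) [Fact (1 ≤ p)] [hp : Fact (p ≠ ∞)] :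
    TopologicalSpace.SeparableSpace (lp (fun _ : ℤ => 𝕜) p) := by
  have h1 : TopologicalSpace.IsSeparable
      (Set.range (fun i : ℤ => (lp.single p i (1 : 𝕜) : lp (fun _ : ℤ => 𝕜) p))) :=
    (Set.countable_range _).isSeparable
  have h2 := (h1.span (R := 𝕜)).closure
  rw [← TopologicalSpace.isSeparable_univ_iff]
  refine h2.mono fun x _ => ?_
  refine mem_closure_of_tendsto (lp.hasSum_single hp.out x) (Eventually.of_forall fun s => ?_)
  refine Submodule.sum_mem _ fun i _ => ?_
  have : lp.single p i (x i : 𝕜) = x i • (lp.single p i (1 : 𝕜) : lp (fun _ : ℤ => 𝕜) p) := by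
    rw [← lp.single_smul, smul_eq_mul, mul_one]
  rw [this]
  exact Submodule.smul_mem _ _ (Submodule.subset_span ⟨i, rfl⟩)

instance lp_nontriv {𝕜 : Type} [RCLike 𝕜] (p : ℝ≥0∞) [Fact (1 ≤ p)] :
    Nontrivial (lp (fun _ : ℤ => 𝕜) p) := ⟨⟨lp.single p 0 (1 : 𝕜), 0, fun h => by
  have := congrArg (fun x : lp (fun _ : ℤ => 𝕜) p => x 0) h
  simp at this⟩⟩

/- ### The weighted shift -/

section shift
variable (M : ℤ → ℝ) (hM : ∀ n, 0 < M n) (K : ℝ) (hK : ∀ n, M (n + 1) ≤ K * M n)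

noncomputable def shiftC0 : C0 ℝ →L[ℝ] C0 ℝ :=
  LinearMap.mkContinuous
    { toFun := fun x => c0mk (fun n => M (n + 1) / M n * x (n + 1)) (by
        have h1 : Tendsto (fun n => x (n + 1)) cofinite (𝓝 0) :=
          (c0_tendsto x).comp (add_left_injective (1 : ℤ)).tendsto_cofinite
        have h2 : Tendsto (fun n => K * ‖x (n + 1)‖) cofinite (𝓝 0) := by
          simpa using h1.norm.const_mul K
        refine squeeze_zero_norm (fun n => ?_) h2
        rw [norm_mul, Real.norm_of_nonneg (div_pos (hM _) (hM _)).le]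
        gcongr
        exact (div_le_iff₀ (hM n)).2 (hK n))
      map_add' := fun x y => by ext n; simp [mul_add]
      map_smul' := fun c x => by ext n; simp [mul_left_comm] } K (by
    intro x
    have hK0 : 0 ≤ K := by
      have := (hM (0 + 1)).trans_le (hK 0)
      exact (pos_of_mul_pos_left this (hM 0).le).le
    apply c0_norm_le _ (mul_nonneg hK0 (norm_nonneg _))
    intro n
    change ‖M (n + 1) / M n * x (n + 1)‖ ≤ _
    rw [norm_mul, Real.norm_of_nonneg (div_pos (hM _) (hM _)).le]
    gcongr
    · exact (div_le_iff₀ (hM n)).2 (hK n)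
    · exact c0_le_norm _ _)

lemma shiftC0_apply (x : C0 ℝ) (n : ℤ) :
    shiftC0 M hM K hK x n = M (n + 1) / M n * x (n + 1) := rfl

lemma shiftC0_iter (x : C0 ℝ) (k : ℕ) (n : ℤ) :
    (shiftC0 M hM K hK)^[k] x n = M (n + k) / M n * x (n + k) := by
  induction k generalizing n with
  | zero => simp [(hM n).ne']
  | succ k ih =>
    rw [iterate_succ_apply', shiftC0_apply, ih]
    have e : n + 1 + (k : ℤ) = n + ((k + 1 : ℕ) : ℤ) := by push_cast; ring
    rw [e]
    have := (hM n).ne'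
    have := (hM (n + 1)).ne'
    field_simp

lemma shiftC0_approx (u v : C0 ℝ) (J : ℕ) (C L : ℝ) (hC : 0 ≤ C) (hL : 0 < L)
    (hu : ∀ j : ℤ, (J : ℤ) < |j| → u j = 0) (hv : ∀ j : ℤ, (J : ℤ) < |j| → v j = 0)
    (hu' : ∀ j, M j * ‖u j‖ ≤ C) (hv' : ∀ j, M j * ‖v j‖ ≤ C) (n : ℕ)
    (hn : ∀ j : ℤ, |j| ≤ J → L ≤ M (j + n) ∧ L ≤ M (j - n)) :
    ∃ x : C0 ℝ, ‖x - u‖ ≤ C / L ∧ ‖(shiftC0 M hM K hK)^[n] x - v‖ ≤ C / L := by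
  have hCL : 0 ≤ C / L := div_nonneg hC hL.le
  let F : C0 ℝ := c0mk (fun j => M (j - n) / M j * v (j - n)) (tendsto_of_finite (by
    refine (Set.finite_Icc ((n : ℤ) - J) (n + J)).subset fun j hj => ?_
    by_contra hj'
    apply hj
    have : (J : ℤ) < |j - n| := by
      by_contra hh
      rw [not_lt, abs_le] at hh
      exact hj' ⟨by omega, by omega⟩
    simp [hv _ this]))
  have aux : ∀ (a b c : ℝ), 0 < b → L ≤ b → a * ‖c‖ ≤ C → 0 ≤ a → ‖a / b * c‖ ≤ C / L := by
    intro a b c hb hLb hac ha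
    rw [norm_mul, Real.norm_of_nonneg (div_nonneg ha hb.le), div_mul_eq_mul_div]
    exact div_le_div₀ hC hac hL hLb
  refine ⟨u + F, ?_, ?_⟩
  · rw [add_sub_cancel_left]
    apply c0_norm_le _ hCL
    intro j
    change ‖M (j - n) / M j * v (j - n)‖ ≤ _
    by_cases hj : |j - n| ≤ (J : ℤ)
    · have := (hn _ hj).1
      rw [sub_add_cancel] at this
      exact aux _ _ _ (hM _) this (hv' _) (hM _).le
    · rw [hv _ (not_le.1 hj)]; simpa using hCL
  · apply c0_norm_le _ hCL
    intro j
    rw [ZeroAtInftyContinuousMap.sub_apply, shiftC0_iter, ZeroAtInftyContinuousMap.add_apply]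
    have hF : F (j + n) = M j / M (j + n) * v j := by
      change M (j + n - n) / M (j + n) * v (j + n - n) = _
      rw [add_sub_cancel_right]
    have e : M (j + n) / M j * (u (j + n) + F (j + n)) - v j = M (j + n) / M j * u (j + n) := by
      rw [hF]
      have := (hM j).ne'
      have := (hM (j + n)).ne'
      field_simp
      ring
    rw [e]
    by_cases hj : |j + n| ≤ (J : ℤ)
    · have := (hn _ hj).2
      rw [add_sub_cancel_right] at this
      exact aux _ _ _ (hM _) this (hu' _) (hM _).le
    · rw [hu _ (not_le.1 hj)]; simpa using hCL

lemma fin_bounds (u : C0 ℝ) (s : Finset ℤ) (hs : ∀ n ∉ s, u n = 0) :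
    ∃ (J : ℕ) (C : ℝ), 0 ≤ C ∧ (∀ j : ℤ, (J : ℤ) < |j| → u j = 0) ∧ ∀ j, M j * ‖u j‖ ≤ C := by
  refine ⟨∑ j ∈ s, j.natAbs, ∑ j ∈ s, |M j * ‖u j‖|, Finset.sum_nonneg fun _ _ => abs_nonneg _,
    fun j hj => hs j fun hjs => ?_, fun j => ?_⟩
  · have := Finset.single_le_sum (f := fun j : ℤ => j.natAbs) (fun _ _ => Nat.zero_le _) hjs
    rw [Int.abs_eq_natAbs] at hj
    omega
  · by_cases hj : j ∈ s
    · exact (le_abs_self _).trans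
        (Finset.single_le_sum (f := fun j => |M j * ‖u j‖|) (fun _ _ => abs_nonneg _) hj)
    · rw [hs j hj, norm_zero, mul_zero]
      exact Finset.sum_nonneg fun _ _ => abs_nonneg _

lemma open_fin (U : Set (C0 ℝ)) (hU : IsOpen U) (nU : U.Nonempty) :
    ∃ (u : C0 ℝ) (ε : ℝ) (J : ℕ) (C : ℝ), 0 < ε ∧ (∀ x, ‖x - u‖ < ε → x ∈ U) ∧ 0 ≤ C ∧
      (∀ j : ℤ, (J : ℤ) < |j| → u j = 0) ∧ ∀ j, M j * ‖u j‖ ≤ C := by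
  obtain ⟨y, hy⟩ := nU
  obtain ⟨ε, hε, hb⟩ := Metric.isOpen_iff.1 hU y hy
  obtain ⟨u, ⟨s, hs⟩, hu⟩ := c0_dense_fin y (half_pos hε)
  obtain ⟨J, C, h0, h1, h2⟩ := fin_bounds M u s hs
  refine ⟨u, ε / 2, J, C, half_pos hε, fun x hx => hb ?_, h0, h1, h2⟩
  rw [Metric.mem_ball, dist_eq_norm]
  calc ‖x - y‖ = ‖(x - u) + (u - y)‖ := by rw [sub_add_sub_cancel]
    _ ≤ ‖x - u‖ + ‖u - y‖ := norm_add_le _ _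
    _ < ε := by linarith

lemma shiftC0_wmix (hn : ∀ J : ℕ, ∃ n : ℕ, ∀ j : ℤ, |j| ≤ J →
    (J : ℝ) ≤ M (j + n) ∧ (J : ℝ) ≤ M (j - n)) : WMix (shiftC0 M hM K hK) := by
  apply topTrans_prod_of_boxes
  intro U₁ V₁ U₂ V₂ hU₁ hV₁ hU₂ hV₂ nU₁ nV₁ nU₂ nV₂
  obtain ⟨u₁, ε₁, J₁, C₁, e₁, k₁, c₁, z₁, b₁⟩ := open_fin M U₁ hU₁ nU₁
  obtain ⟨u₂, ε₂, J₂, C₂, e₂, k₂, c₂, z₂, b₂⟩ := open_fin M U₂ hU₂ nU₂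
  obtain ⟨u₃, ε₃, J₃, C₃, e₃, k₃, c₃, z₃, b₃⟩ := open_fin M V₁ hV₁ nV₁
  obtain ⟨u₄, ε₄, J₄, C₄, e₄, k₄, c₄, z₄, b₄⟩ := open_fin M V₂ hV₂ nV₂
  set C := C₁ + C₂ + C₃ + C₄
  obtain ⟨ε, hε, l₁, l₂, l₃, l₄⟩ : ∃ ε : ℝ, 0 < ε ∧ ε ≤ ε₁ ∧ ε ≤ ε₂ ∧ ε ≤ ε₃ ∧ ε ≤ ε₄ :=
    ⟨min (min ε₁ ε₂) (min ε₃ ε₄), lt_min (lt_min e₁ e₂) (lt_min e₃ e₄), by simp, by simp,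
      by simp, by simp⟩
  obtain ⟨N, hN⟩ := exists_nat_gt (C / ε)
  set J := J₁ + J₂ + J₃ + J₄ + N + 1
  obtain ⟨n, hn⟩ := hn J
  have hC : 0 ≤ C := by positivity
  have hJ : (0 : ℝ) < J := by positivity
  have hCJ : C / J < ε := by
    rw [div_lt_iff₀ hJ]
    rw [div_lt_iff₀ hε] at hN
    have : (N : ℝ) ≤ J := by exact_mod_cast (by omega : N ≤ J)
    nlinarith
  obtain ⟨x, hx, hx'⟩ := shiftC0_approx M hM K hK u₁ u₃ J C J hC hJ
    (fun j hj => z₁ j (by omega)) (fun j hj => z₃ j (by omega))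
    (fun j => (b₁ j).trans (by linarith)) (fun j => (b₃ j).trans (by linarith)) n hn
  obtain ⟨y, hy, hy'⟩ := shiftC0_approx M hM K hK u₂ u₄ J C J hC hJ
    (fun j hj => z₂ j (by omega)) (fun j hj => z₄ j (by omega))
    (fun j => (b₂ j).trans (by linarith)) (fun j => (b₄ j).trans (by linarith)) n hn
  exact ⟨n, ⟨x, k₁ _ (by linarith), k₃ _ (by linarith)⟩,
    ⟨y, k₂ _ (by linarith), k₄ _ (by linarith)⟩⟩

end shift

/-- The key construction: for a non-syndetic set `D`, there is an invertible weakly mixing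
bilateral weighted backward shift on `c₀(ℤ)` with a return set disjoint from `D`. -/
lemma exists_shift (D : Set ℕ) (hD : ¬ IsSyndetic D) :
    ∃ (w : ℤ → ℝ) (B : C0 ℝ →L[ℝ] C0 ℝ), IsInvertibleWBSc0 ℝ w B ∧ WMix B ∧
      ∃ U V : Set (C0 ℝ), IsOpen U ∧ IsOpen V ∧ U.Nonempty ∧ V.Nonempty ∧
        ∀ n ∈ nset B U V, n ∉ D := by
  let E : Set ℝ := insert 0 ((fun n : ℕ => (n : ℝ)) '' D)
  have hE : E.Nonempty := ⟨0, mem_insert _ _⟩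
  let M : ℤ → ℝ := fun n => Real.exp (Metric.infDist (|(n : ℝ)|) E)
  have hM : ∀ n, 0 < M n := fun n => Real.exp_pos _
  have hLip : ∀ m n : ℤ, |(m : ℝ) - n| ≤ 1 → M m ≤ Real.exp 1 * M n := by
    intro m n h
    rw [← Real.exp_add]
    apply Real.exp_le_exp.2
    have h1 := Metric.infDist_le_infDist_add_dist (s := E) (x := |(m : ℝ)|) (y := |(n : ℝ)|)
    have h2 : dist |(m : ℝ)| |(n : ℝ)| ≤ |(m : ℝ) - n| := abs_abs_sub_abs_le _ _
    linarith
  have hK : ∀ n, M (n + 1) ≤ Real.exp 1 * M n := fun n => hLip _ _ (by simp)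
  refine ⟨fun n => M n / M (n - 1), shiftC0 M hM _ hK, ⟨fun n => div_pos (hM _) (hM _),
    ⟨Real.exp 1, fun n => (div_le_iff₀ (hM _)).2 (hLip _ _ (by simp))⟩,
    ⟨(Real.exp 1)⁻¹, by positivity, fun n => ?_⟩, fun x n => ?_⟩, ?_,
    Metric.ball 0 (1 / 2), Metric.ball (c0e 0) (1 / 2), Metric.isOpen_ball, Metric.isOpen_ball,
    ⟨0, by simp⟩, ⟨c0e 0, by simp⟩, ?_⟩
  · rw [le_div_iff₀ (hM _), inv_mul_le_iff₀ (Real.exp_pos 1)]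
    exact hLip _ _ (by simp)
  · simp only [shiftC0_apply, add_sub_cancel_right, smul_eq_mul]
  · apply shiftC0_wmix
    intro J
    simp only [IsSyndetic, not_exists, not_forall, not_and] at hD
    obtain ⟨N, hN⟩ := hD (10 * J)
    have key : ∀ i : ℤ, (N : ℤ) + J ≤ i → i ≤ N + 9 * J → (J : ℝ) ≤ M i ∧ (J : ℝ) ≤ M (-i) := by
      intro i hi hi'
      have hd : (J : ℝ) ≤ Metric.infDist |(i : ℝ)| E := by
        rw [Metric.le_infDist hE]
        have hi0 : (0 : ℝ) ≤ i := by exact_mod_cast (by omega : 0 ≤ i)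
        rw [abs_of_nonneg hi0]
        rintro _ (rfl | ⟨d, hd, rfl⟩)
        · rw [Real.dist_eq, sub_zero, abs_of_nonneg hi0]
          exact_mod_cast (by omega : (J : ℤ) ≤ i)
        · have h1 := hN d hd
          have h2 : (J : ℤ) ≤ |i - d| := by
            by_contra hlt
            rw [not_le, abs_lt] at hlt
            exact h1 (by omega) (by omega)
          rw [Real.dist_eq]
          change (J : ℝ) ≤ |(i : ℝ) - (d : ℝ)|
          exact_mod_cast h2
      have h3 : (J : ℝ) ≤ Real.exp (Metric.infDist |(i : ℝ)| E) := by
        have := Real.add_one_le_exp (Metric.infDist |(i : ℝ)| E)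
        linarith
      refine ⟨h3, ?_⟩
      simpa [M] using h3
    refine ⟨N + 5 * J, fun j hj => ?_⟩
    rw [abs_le] at hj
    refine ⟨(key _ (by push_cast; omega) (by push_cast; omega)).1, ?_⟩
    have := (key (-(j - (N + 5 * J : ℕ))) (by push_cast; omega) (by push_cast; omega)).2
    rwa [neg_neg] at this
  · rintro n ⟨x, hx, hx'⟩ hnD
    rw [Metric.mem_ball, dist_eq_norm] at hx hx'
    have h1 := (c0_le_norm _ (n : ℤ)).trans_lt hx
    have h2 := (c0_le_norm _ (0 : ℤ)).trans_lt hx'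
    rw [ZeroAtInftyContinuousMap.sub_apply, shiftC0_iter, c0e_self] at h2
    have hM0 : M 0 = 1 := by
      have : Metric.infDist |((0 : ℤ) : ℝ)| E = 0 :=
        Metric.infDist_zero_of_mem (by simp [E])
      simp only [M, this, Real.exp_zero]
    have hMn : M (0 + n) = 1 := by
      have : Metric.infDist |((0 + n : ℤ) : ℝ)| E = 0 :=
        Metric.infDist_zero_of_mem (mem_insert_of_mem _ ⟨n, hnD, by simp⟩)
      simp only [M, this, Real.exp_zero]
    rw [hM0, hMn, zero_add, div_one, one_mul, Real.norm_eq_abs, abs_lt] at h2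
    rw [sub_zero, Real.norm_eq_abs, abs_lt] at h1
    linarith [h1.1, h1.2, h2.1, h2.2]

/- ### Assembling -/

lemma frechet_neBot (T : FrechetOp) (x : T.X) : NeBot (𝓝[≠] x) := by
  letI := T.instField
  have : Nontrivial T.X := by
    by_contra h
    rw [not_nontrivial_iff_subsingleton] at h
    exact T.infDim inferInstance
  exact Module.punctured_nhds_neBot T.𝕜 T.X x

lemma frechet_cg (T : FrechetOp) : (uniformity T.X).IsCountablyGenerated :=
  IsUniformAddGroup.uniformity_countably_generated

lemma prod_neBot {X Y : Type*} [TopologicalSpace X] [TopologicalSpace Y] (y : X × Y)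
    [h : NeBot (𝓝[≠] y.1)] : NeBot (𝓝[≠] y) := by
  rw [← mem_closure_iff_nhdsWithin_neBot, mem_closure_iff_nhds] at *
  intro t ht
  have hc : Continuous fun x : X => (x, y.2) := by fun_prop
  obtain ⟨x, hx, hx'⟩ := h _ (hc.continuousAt.preimage_mem_nhds (x := y.1) ht)
  exact ⟨_, hx, fun e => hx' (congrArg Prod.fst e)⟩

lemma wd_of_wmix {X Y : Type*} [UniformSpace X] [CompleteSpace X] [TopologicalSpace.SeparableSpace X]
    [(uniformity X).IsCountablyGenerated] [UniformSpace Y] [CompleteSpace Y] [Nonempty X]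
    [Nonempty Y] [TopologicalSpace.SeparableSpace Y] [(uniformity Y).IsCountablyGenerated]
    {T : X → X} {S : Y → Y} (hT : Continuous T) (hS : Continuous S)
    (h : WMix (prodMap' T S)) : WeaklyDisjoint T S := by
  have := UniformSpace.secondCountable_of_separable X
  have := UniformSpace.secondCountable_of_separable Y
  exact TopTrans.hypercyclic
    ((hT.comp continuous_fst).prodMk (hS.comp continuous_snd)) h.topTrans

/-- For an operator `T` the following are equivalent:
(1) `T` is topologically ergodic; (2) `T` is weakly disjoint from every weakly mixing
operator; (3) `T` is weakly disjoint from every invertible weakly mixing bilateral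
weighted backward shift on `c₀(ℤ)` or `ℓᵖ(ℤ)`, `1 ≤ p < ∞`; (4) `T ⊕ S` is weakly
mixing for every such shift `S`; (5) `T ⊕ S` is weakly mixing for every weakly mixing
operator `S`. -/
theorem topErgodic_iff_weaklyDisjoint_from_weaklyMixing (T : FrechetOp) :
    (TopErgodic T.T ↔
      ∀ S : FrechetOp, WMix S.T → WeaklyDisjoint T.T S.T) ∧
    (TopErgodic T.T ↔
      ∀ (𝕜 : Type) [RCLike 𝕜],
        (∀ (p : ℝ≥0∞) [Fact (1 ≤ p)], p ≠ ∞ →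
          ∀ (w : ℤ → ℝ) (B : lp (fun _ : ℤ => 𝕜) p →L[𝕜] lp (fun _ : ℤ => 𝕜) p),
            IsInvertibleWBSlp 𝕜 p w B → WMix ⇑B → WeaklyDisjoint T.T ⇑B) ∧
        (∀ (w : ℤ → ℝ) (B : ZeroAtInftyContinuousMap ℤ 𝕜 →L[𝕜] ZeroAtInftyContinuousMap ℤ 𝕜),
            IsInvertibleWBSc0 𝕜 w B → WMix ⇑B → WeaklyDisjoint T.T ⇑B)) ∧
    (TopErgodic T.T ↔
      ∀ (𝕜 : Type) [RCLike 𝕜],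
        (∀ (p : ℝ≥0∞) [Fact (1 ≤ p)], p ≠ ∞ →
          ∀ (w : ℤ → ℝ) (B : lp (fun _ : ℤ => 𝕜) p →L[𝕜] lp (fun _ : ℤ => 𝕜) p),
            IsInvertibleWBSlp 𝕜 p w B → WMix ⇑B → WMix (prodMap' T.T ⇑B)) ∧
        (∀ (w : ℤ → ℝ) (B : ZeroAtInftyContinuousMap ℤ 𝕜 →L[𝕜] ZeroAtInftyContinuousMap ℤ 𝕜),
            IsInvertibleWBSc0 𝕜 w B → WMix ⇑B → WMix (prodMap' T.T ⇑B))) ∧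
    (TopErgodic T.T ↔
      ∀ S : FrechetOp, WMix S.T → WMix (prodMap' T.T S.T)) := by
  have nbT : ∀ x : T.X, NeBot (𝓝[≠] x) := frechet_neBot T
  let _ := T.instField
  have addT : ∀ x y, T.T (x + y) = T.T x + T.T y := T.linear.map_add
  -- the ergodic direction
  have fwdS : TopErgodic T.T → ∀ S : FrechetOp, WMix S.T → WMix (prodMap' T.T S.T) := by
    intro h S hS
    have := frechet_neBot S
    exact erg_prod_wmix T.cont addT h S.cont hS
  have fwdlp : TopErgodic T.T → ∀ (𝕜 : Type) [RCLike 𝕜] (p : ℝ≥0∞) [Fact (1 ≤ p)], p ≠ ∞ →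
      ∀ (B : lp (fun _ : ℤ => 𝕜) p →L[𝕜] lp (fun _ : ℤ => 𝕜) p), WMix ⇑B →
        WMix (prodMap' T.T ⇑B) := by
    intro h 𝕜 _ p _ hp B hB
    have : ∀ y : lp (fun _ : ℤ => 𝕜) p, NeBot (𝓝[≠] y) := fun y =>
      Module.punctured_nhds_neBot 𝕜 _ y
    exact erg_prod_wmix T.cont addT h B.continuous hB
  have fwdc0 : TopErgodic T.T → ∀ (𝕜 : Type) [RCLike 𝕜] (B : C0 𝕜 →L[𝕜] C0 𝕜), WMix ⇑B →
        WMix (prodMap' T.T ⇑B) := by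
    intro h 𝕜 _ B hB
    have : ∀ y : C0 𝕜, NeBot (𝓝[≠] y) := fun y => Module.punctured_nhds_neBot 𝕜 _ y
    exact erg_prod_wmix T.cont addT h B.continuous hB
  have hcg := frechet_cg T
  -- the converse direction
  have core : (∀ (w : ℤ → ℝ) (B : C0 ℝ →L[ℝ] C0 ℝ), IsInvertibleWBSc0 ℝ w B → WMix ⇑B →
      TopTrans (prodMap' T.T ⇑B)) → TopErgodic T.T := by
    intro h U V hU hV nU nV
    by_contra hD
    obtain ⟨w, B, hwB, hB, U', V', hU', hV', nU', nV', hdis⟩ := exists_shift _ hD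
    obtain ⟨n, h1, h2⟩ := boxes_of_topTrans_prod (h w B hwB hB) U V U' V' hU hV hU' hV'
      nU nV nU' nV'
    exact hdis n h2 h1
  have nbP : ∀ y : T.X × C0 ℝ, NeBot (𝓝[≠] y) := fun y => by
    have := nbT y.1
    exact prod_neBot y
  let mk : (C0 ℝ →L[ℝ] C0 ℝ) → FrechetOp := fun B =>
    { 𝕜 := ℝ, X := C0 ℝ, infDim := c0_infDim, T := B, linear := B.toLinearMap.isLinear,
      cont := B.continuous }
  refine ⟨⟨fun h S hS => ?_, fun h => core fun w B hwB hB => ?_⟩,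
    ⟨fun h 𝕜 _ => ⟨fun p _ hp w B hwB hB => ?_, fun w B hwB hB => ?_⟩,
      fun h => core fun w B hwB hB => ?_⟩,
    ⟨fun h 𝕜 _ => ⟨fun p _ hp w B hwB hB => fwdlp h 𝕜 p hp B hB,
      fun w B hwB hB => fwdc0 h 𝕜 B hB⟩, fun h => core fun w B hwB hB => ?_⟩,
    ⟨fwdS, fun h => core fun w B hwB hB => ?_⟩⟩
  · have := frechet_cg S
    exact wd_of_wmix T.cont S.cont (fwdS h S hS)
  · exact HypercyclicMap.topTrans (h (mk B) hB)
  · have : Fact (p ≠ ∞) := ⟨hp⟩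
    exact wd_of_wmix T.cont B.continuous (fwdlp h 𝕜 p hp B hB)
  · exact wd_of_wmix T.cont B.continuous (fwdc0 h 𝕜 B hB)
  · exact HypercyclicMap.topTrans ((h ℝ).2 w B hwB hB)
  · exact ((h ℝ).2 w B hwB hB).topTrans
  · exact (h (mk B) hB).topTrans
end

section
/- Let F₁ be a shift-invariant thick Furstenberg family and let F₂ be a Furstenberg family. Then there exists an invertible F₁-transitive operator (on some infinite-dimensional separable Fréchet space) which is not F₂-transitive if and only if F₁ \ F₂ ≠ ∅. -/
open Set Topology Function Filter
open scoped ENNReal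

/- ### Proof -/

abbrev L1Z : Type := lp (fun _ : ℤ => ℝ) 1

lemma L1Z.summable (x : L1Z) : Summable (fun i => |x i|) := by
  have := (memℓp_gen_iff (p := 1) (by simp)).1 (lp.memℓp x)
  simpa using this

lemma L1Z.norm_eq (x : L1Z) : ‖x‖ = ∑' i, |x i| := by
  have := lp.norm_eq_tsum_rpow (p := 1) (by simp) x
  simpa using this

lemma shiftw_bound (d : ℤ → ℝ) (hd : ∀ n m, d n - d m ≤ |((n - m : ℤ) : ℝ)|) (s : ℤ)
    (x : L1Z) (n : ℤ) :
    |Real.exp (d (n + s) - d n) * x (n + s)| ≤ Real.exp |(s : ℝ)| * |x (n + s)| := by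
  rw [abs_mul, abs_of_pos (Real.exp_pos _)]
  have := hd (n + s) n
  rw [add_sub_cancel_left] at this
  gcongr

lemma summable_shift (x : L1Z) (s : ℤ) : Summable (fun n => |x (n + s)|) :=
  (Equiv.addRight s).summable_iff.2 (L1Z.summable x)

/-- The (power of the) weighted shift. -/
noncomputable def shiftw (d : ℤ → ℝ) (hd : ∀ n m, d n - d m ≤ |((n - m : ℤ) : ℝ)|) (s : ℤ) :
    L1Z →L[ℝ] L1Z :=
  LinearMap.mkContinuous
    { toFun := fun x => ⟨fun n => Real.exp (d (n + s) - d n) * x (n + s), by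
        apply memℓp_gen
        simp only [ENNReal.toReal_one, Real.rpow_one, Real.norm_eq_abs]
        exact Summable.of_nonneg_of_le (fun _ => abs_nonneg _) (shiftw_bound d hd s x)
          ((summable_shift x s).mul_left _)⟩
      map_add' := by
        intro x y
        ext n
        exact mul_add _ _ _
      map_smul' := by
        intro c x
        ext n
        simp
        ring }
    (Real.exp |(s : ℝ)|) (by
      intro x
      rw [L1Z.norm_eq, L1Z.norm_eq x, ← (Equiv.addRight s).tsum_eq (fun i => |x i|), ← tsum_mul_left]
      have h2 : Summable (fun n => Real.exp |(s : ℝ)| * |x (n + s)|) :=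
        (summable_shift x s).mul_left _
      exact Summable.tsum_le_tsum (shiftw_bound d hd s x)
        (Summable.of_nonneg_of_le (fun _ => abs_nonneg _) (shiftw_bound d hd s x) h2) h2)

section
variable (d : ℤ → ℝ) (hd : ∀ n m, d n - d m ≤ |((n - m : ℤ) : ℝ)|)

lemma shiftw_apply (s : ℤ) (x : L1Z) (n : ℤ) :
    shiftw d hd s x n = Real.exp (d (n + s) - d n) * x (n + s) := rfl

lemma shiftw_comp (s t : ℤ) (x : L1Z) :
    shiftw d hd s (shiftw d hd t x) = shiftw d hd (s + t) x := by
  ext n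
  simp only [shiftw_apply, ← mul_assoc, ← Real.exp_add, add_assoc]
  congr 2
  ring

lemma shiftw_zero (x : L1Z) : shiftw d hd 0 x = x := by
  ext n
  simp [shiftw_apply]

lemma shiftw_iter (n : ℕ) (x : L1Z) : (shiftw d hd 1)^[n] x = shiftw d hd n x := by
  induction n with
  | zero => simp [shiftw_zero]
  | succ k ih =>
    rw [Function.iterate_succ_apply', ih, shiftw_comp]
    congr 2
    push_cast
    ring

lemma shiftw_single (s i : ℤ) (a : ℝ) :
    ‖shiftw d hd s (lp.single 1 i a)‖ = Real.exp (d i - d (i - s)) * |a| := by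
  have : shiftw d hd s (lp.single 1 i a) =
      lp.single 1 (i - s) (Real.exp (d i - d (i - s)) * a) := by
    ext n
    rw [shiftw_apply]
    by_cases h : n = i - s
    · subst h
      simp
    · have h' : n + s ≠ i := fun h' => h (by omega)
      rw [lp.single_apply_ne _ _ _ h, lp.single_apply_ne _ _ _ h', mul_zero]
  rw [this, lp.norm_single (by simp), Real.norm_eq_abs, abs_mul, abs_of_pos (Real.exp_pos _)]

end

/-- Deep points of `A`. -/
def deepSet (A : Set ℕ) (K : ℕ) : Set ℕ :=
  {n | K ≤ n ∧ ∀ m, n ≤ m + K → m ≤ n + K → m ∈ A}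

lemma deepSet_anti (A : Set ℕ) {K L : ℕ} (h : K ≤ L) : deepSet A L ⊆ deepSet A K := by
  rintro n ⟨h1, h2⟩
  exact ⟨h.trans h1, fun m h3 h4 => h2 m (by omega) (by omega)⟩

lemma deepSet_mem {F : Set (Set ℕ)} (h₁ : IsFamily F) (hsi : ShiftInvariant F)
    (hth : ThickFamily F) {A : Set ℕ} (hA : A ∈ F) (K : ℕ) : deepSet A K ∈ F := by
  refine h₁.2.1 (hsi _ (hth A hA (2 * K)) K) ?_
  rintro n ⟨m, hm, hn⟩
  refine ⟨by omega, fun j h1 h2 => ?_⟩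
  have := hm (j - m) (by omega)
  rwa [show m + (j - m) = j by omega] at this

/-- Complement of the symmetrized set, with zero. -/
def badSet (A : Set ℕ) : Set ℤ := {z | z.natAbs ∉ A ∨ z = 0}

noncomputable def depth (A : Set ℕ) (n : ℤ) : ℝ := Metric.infDist n (badSet A)

lemma depth_lip (A : Set ℕ) (n m : ℤ) : depth A n - depth A m ≤ |((n - m : ℤ) : ℝ)| := by
  have := Metric.infDist_le_infDist_add_dist (s := badSet A) (x := n) (y := m)
  rw [Int.dist_eq] at this
  push_cast
  unfold depth
  linarith

lemma depth_bad (A : Set ℕ) {n : ℤ} (h : n ∈ badSet A) : depth A n = 0 :=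
  Metric.infDist_zero_of_mem h

lemma le_depth (A : Set ℕ) (L : ℕ) (i s : ℤ) (n : ℕ) (hs : s.natAbs = n)
    (hn : n ∈ deepSet A (i.natAbs + L)) : (L : ℝ) ≤ depth A (i - s) := by
  refine (Metric.le_infDist (s := badSet A) ⟨0, Or.inr rfl⟩).2 ?_
  intro b hb
  rw [Int.dist_eq]
  by_contra! hlt
  have hlt' : |(i - s) - b| < (L : ℤ) := by exact_mod_cast hlt
  rw [abs_lt] at hlt'
  obtain ⟨h1, h2⟩ := hn
  rcases hb with hb | hb
  · exact hb (h2 _ (by omega) (by omega))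
  · omega

lemma exists_small (A : Set ℕ) (x : L1Z) (hx : x ∈ Submodule.span ℝ
      (Set.range fun i : ℤ => (lp.single 1 i (1 : ℝ) : L1Z))) :
    ∀ ε > 0, ∃ K, ∀ n ∈ deepSet A K, ∀ s : ℤ, s.natAbs = n →
      ‖shiftw (depth A) (depth_lip A) s x‖ < ε := by
  induction hx using Submodule.span_induction with
  | mem x h =>
    obtain ⟨i, rfl⟩ := h
    intro ε hε
    have ht : Tendsto (fun L : ℕ => Real.exp (depth A i - L)) atTop (𝓝 0) :=
      Real.tendsto_exp_atBot.comp
        (tendsto_atBot_add_const_left _ _ (tendsto_neg_atTop_atBot.comp tendsto_natCast_atTop_atTop))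
    obtain ⟨L, hL⟩ := (ht.eventually_lt_const hε).exists
    refine ⟨i.natAbs + L, fun n hn s hs => ?_⟩
    simp only [shiftw_single]
    have := le_depth A L i s n hs hn
    rw [abs_one, mul_one]
    refine lt_of_le_of_lt ?_ hL
    gcongr
  | zero =>
    intro ε hε
    exact ⟨0, fun n hn s hs => by simpa using hε⟩
  | add x y _ _ hx hy =>
    intro ε hε
    obtain ⟨K, hK⟩ := hx (ε / 2) (by positivity)
    obtain ⟨L, hL⟩ := hy (ε / 2) (by positivity)
    refine ⟨max K L, fun n hn s hs => ?_⟩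
    rw [map_add]
    have h1 := hK n (deepSet_anti A (le_max_left _ _) hn) s hs
    have h2 := hL n (deepSet_anti A (le_max_right _ _) hn) s hs
    exact (norm_add_le _ _).trans_lt (by linarith)
  | smul c x _ hx =>
    intro ε hε
    obtain ⟨K, hK⟩ := hx (ε / (|c| + 1)) (by positivity)
    refine ⟨K, fun n hn s hs => ?_⟩
    have h := hK n hn s hs
    rw [map_smul, norm_smul, Real.norm_eq_abs]
    rw [lt_div_iff₀ (by positivity)] at h
    nlinarith [norm_nonneg (shiftw (depth A) (depth_lip A) s x)]

lemma dense_span_single : Dense (Submodule.span ℝ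
      (Set.range fun i : ℤ => (lp.single 1 i (1 : ℝ) : L1Z)) : Set L1Z) := by
  intro x
  have h := lp.hasSum_single (p := 1) (by simp) x
  refine mem_closure_of_tendsto h (Eventually.of_forall fun s => ?_)
  refine Submodule.sum_mem _ fun i _ => ?_
  have : (lp.single 1 i (x i) : L1Z) = x i • lp.single 1 i (1 : ℝ) := by
    rw [← lp.single_smul]; simp
  rw [this]
  exact Submodule.smul_mem _ _ (Submodule.subset_span ⟨i, rfl⟩)

instance L1Z.separable : TopologicalSpace.SeparableSpace L1Z := by
  have h : TopologicalSpace.IsSeparable (Submodule.span ℝ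
      (Set.range fun i : ℤ => (lp.single 1 i (1 : ℝ) : L1Z)) : Set L1Z) :=
    (Set.countable_range _).isSeparable.span
  rw [← TopologicalSpace.isSeparable_univ_iff, ← dense_span_single.closure_eq]
  exact h.closure

lemma L1Z.infDim : ¬ FiniteDimensional ℝ L1Z := by
  intro h
  have hli : LinearIndependent ℝ (fun i : ℤ => (lp.single 1 i (1 : ℝ) : L1Z)) := by
    rw [linearIndependent_iff']
    intro s g hg i hi
    have := congrArg (fun x : L1Z => x i) hg
    simp only [lp.coeFn_sum, Finset.sum_apply, lp.coeFn_smul, Pi.smul_apply, lp.coeFn_zero,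
      Pi.zero_apply, smul_eq_mul] at this
    rw [Finset.sum_eq_single i] at this
    · simpa using this
    · intro j _ hj
      rw [lp.single_apply_ne _ _ _ hj.symm, mul_zero]
    · exact fun h => absurd hi h
  exact not_finite_iff_infinite.2 (inferInstanceAs (Infinite ℤ)) hli.finite

/-- The operator attached to `A`. -/
noncomputable def opOf (A : Set ℕ) : FrechetOp where
  𝕜 := ℝ
  X := L1Z
  infDim := L1Z.infDim
  T := shiftw (depth A) (depth_lip A) 1
  linear := (shiftw (depth A) (depth_lip A) 1).toLinearMap.isLinear
  cont := (shiftw (depth A) (depth_lip A) 1).continuous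

lemma opOf_trans {F : Set (Set ℕ)} (h₁ : IsFamily F) (hsi : ShiftInvariant F)
    (hth : ThickFamily F) {A : Set ℕ} (hA : A ∈ F) :
    FTrans (shiftw (depth A) (depth_lip A) 1) F := by
  intro U V hU hV hUn hVn
  obtain ⟨u, hu, huD⟩ := dense_span_single.inter_open_nonempty U hU hUn
  obtain ⟨w, hw, hwD⟩ := dense_span_single.inter_open_nonempty V hV hVn
  obtain ⟨ε, hε, hεU⟩ := Metric.isOpen_iff.1 hU u hu
  obtain ⟨δ, hδ, hδV⟩ := Metric.isOpen_iff.1 hV w hw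
  obtain ⟨K, hK⟩ := exists_small A u huD δ hδ
  obtain ⟨L, hL⟩ := exists_small A w hwD ε hε
  refine h₁.2.1 (deepSet_mem h₁ hsi hth hA (max K L)) fun n hn => ?_
  refine ⟨u + shiftw (depth A) (depth_lip A) (-n) w, hεU ?_, hδV ?_⟩
  · rw [Metric.mem_ball, dist_eq_norm, add_sub_cancel_left]
    exact hL n (deepSet_anti A (le_max_right _ _) hn) _ (by simp)
  · rw [shiftw_iter, map_add, shiftw_comp, add_neg_cancel, shiftw_zero, Metric.mem_ball,
      dist_eq_norm, add_sub_cancel_right]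
    exact hK n (deepSet_anti A (le_max_left _ _) hn) _ (by simp)

lemma opOf_not_trans {F : Set (Set ℕ)} (h : IsFamily F) {A : Set ℕ} (hA : A ∉ F) :
    ¬ FTrans (shiftw (depth A) (depth_lip A) 1) F := by
  intro hT
  have hcont : Continuous fun y : L1Z => y 0 := by
    refine (LipschitzWith.of_dist_le_mul (K := 1) fun x y => ?_).continuous
    have := lp.norm_apply_le_norm (p := 1) (by simp) (x - y) 0
    simpa [dist_eq_norm] using this
  refine hA (h.2.1 (hT (Metric.ball 0 1) {y | 1 < y 0} Metric.isOpen_ball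
    (isOpen_lt continuous_const hcont) ⟨0, by simp⟩ ⟨lp.single 1 0 2, by simp⟩) ?_)
  rintro n ⟨x, hx, hy⟩
  by_contra hn
  rw [shiftw_iter, Set.mem_ofPred_eq, shiftw_apply, depth_bad A (n := 0) (Or.inr rfl), zero_add,
    depth_bad A (n := n) (Or.inl (by simpa using hn))] at hy
  have h2 := lp.norm_apply_le_norm (p := 1) (by simp) x n
  rw [mem_ball_zero_iff] at hx
  rw [Real.norm_eq_abs] at h2
  simp at hy
  linarith [le_abs_self (x n)]

/-- Let `F₁` be a shift-invariant thick Furstenberg family and `F₂` a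
Furstenberg family. There exists an invertible `F₁`-transitive operator which is not
`F₂`-transitive iff `F₁ \ F₂ ≠ ∅`. -/
theorem exists_invertible_F1_transitive_not_F2_transitive_iff
    (F₁ F₂ : Set (Set ℕ)) (h₁ : IsFamily F₁) (hsi : ShiftInvariant F₁)
    (hth : ThickFamily F₁) (h₂ : IsFamily F₂) :
    (∃ S : FrechetOp, S.Invertible ∧ FTrans S.T F₁ ∧ ¬ FTrans S.T F₂) ↔
      (F₁ \ F₂).Nonempty := by
  constructor
  · rintro ⟨S, -, hF₁, hF₂⟩
    unfold FTrans at hF₂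
    push Not at hF₂
    obtain ⟨U, V, hU, hV, hUn, hVn, h⟩ := hF₂
    exact ⟨_, hF₁ U V hU hV hUn hVn, h⟩
  · rintro ⟨A, hA₁, hA₂⟩
    refine ⟨opOf A, ⟨shiftw (depth A) (depth_lip A) (-1),
      (shiftw (depth A) (depth_lip A) (-1)).continuous, fun x => ?_, fun x => ?_⟩,
      opOf_trans h₁ hsi hth hA₁, opOf_not_trans h₂ hA₂⟩
    · exact (shiftw_comp _ _ (-1) 1 x).trans (shiftw_zero _ _ x)
    · exact (shiftw_comp _ _ 1 (-1) x).trans (shiftw_zero _ _ x)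
end

section
/- Let F₁ and F₂ be shift-invariant thick Furstenberg families. Then there exist an invertible F₁-transitive operator T : X → X and an invertible F₂-transitive operator S : Y → Y (on infinite-dimensional separable Fréchet spaces) such that T is not weakly disjoint from S, if and only if there exist F₁ ∈ F₁ and F₂ ∈ F₂ with F₁ ∩ F₂ = ∅. -/
open Set Topology Function Filter
open scoped ENNReal

open scoped ZeroAtInfty

namespace WDProof

/-- the sequence space -/
abbrev E := C₀(ℤ, ℝ)

lemma norm_le_iff' (f : E) {C : ℝ} (hC : 0 ≤ C) : ‖f‖ ≤ C ↔ ∀ n, |f n| ≤ C := by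
  rw [← ZeroAtInftyContinuousMap.norm_toBCF_eq_norm, BoundedContinuousFunction.norm_le hC]
  rfl

lemma abs_le_norm (f : E) (n : ℤ) : |f n| ≤ ‖f‖ :=
  (norm_le_iff' f (norm_nonneg f)).1 le_rfl n

/-- unit vectors -/
noncomputable def e (n : ℤ) : E where
  toFun := fun k => if k = n then 1 else 0
  continuous_toFun := continuous_of_discreteTopology
  zero_at_infty' := by
    refine tendsto_nhds_of_eventually_eq ?_
    rw [Filter.cocompact_eq_cofinite]
    filter_upwards [(Set.finite_singleton n).compl_mem_cofinite] with k hk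
    simpa using hk

lemma e_apply (n k : ℤ) : e n k = if k = n then 1 else 0 := rfl

lemma sum_e_apply (s : Finset ℤ) (c : ℤ → ℝ) (k : ℤ) :
    (∑ n ∈ s, c n • e n : E) k = if k ∈ s then c k else 0 := by
  have : (∑ n ∈ s, c n • e n : E) k = ∑ n ∈ s, (c n • e n : E) k := by
    induction s using Finset.induction_on with
    | empty => simp
    | insert a s ha ih => rw [Finset.sum_insert ha, Finset.sum_insert ha, ← ih]; rfl
  rw [this]
  simp [e_apply]

lemma infDimE : ¬ FiniteDimensional ℝ E := by
  intro h
  have hli : LinearIndependent ℝ e := by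
    rw [linearIndependent_iff']
    intro s c hc i hi
    have := sum_e_apply s c i
    rw [hc] at this
    simpa [hi] using this.symm
  have := hli.finite
  exact not_finite ℤ

lemma approx (f : E) {ε : ℝ} (hε : 0 < ε) :
    ∃ s : Finset ℤ, ‖(∑ n ∈ s, f n • e n : E) - f‖ < ε := by
  have h := f.zero_at_infty'
  rw [Filter.cocompact_eq_cofinite] at h
  have h2 : ∀ᶠ k in cofinite, |f k| < ε / 2 := by
    have := (Metric.tendsto_nhds.1 h) (ε / 2) (half_pos hε)
    filter_upwards [this] with k hk
    simpa [Real.dist_eq] using hk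
  have hfin : {k | ¬ |f k| < ε / 2}.Finite := h2
  refine ⟨hfin.toFinset, lt_of_le_of_lt ?_ (half_lt_self hε)⟩
  rw [norm_le_iff' _ (half_pos hε).le]
  intro k
  change |(∑ n ∈ hfin.toFinset, f n • e n : E) k - f k| ≤ _
  rw [sum_e_apply]
  split_ifs with hk
  · simpa using (half_pos hε).le
  · simp at hk
    simpa using hk.le

lemma dense_span : Dense (Submodule.span ℝ (range e) : Set E) := by
  intro f
  rw [Metric.mem_closure_iff]
  intro ε hε
  obtain ⟨s, hs⟩ := approx f hε
  refine ⟨_, Submodule.sum_mem _ (fun n _ => Submodule.smul_mem _ (f n)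
    (Submodule.subset_span ⟨n, rfl⟩)) (t := s), ?_⟩
  rwa [dist_comm, dist_eq_norm]

instance : TopologicalSpace.SeparableSpace E := by
  have h : TopologicalSpace.IsSeparable (Submodule.span ℝ (range e) : Set E) :=
    (Set.countable_range e).isSeparable.span
  have := h.closure
  rw [dense_span.closure_eq] at this
  exact TopologicalSpace.isSeparable_univ_iff.1 this

/-- finitely supported vectors meet open sets -/
lemma exists_supp {U : Set E} (hU : IsOpen U) (hne : U.Nonempty) :
    ∃ x ∈ U, ∃ m : ℕ, ∀ n : ℤ, (m : ℝ) < |(n : ℝ)| → x n = 0 := by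
  obtain ⟨f, hf⟩ := hne
  obtain ⟨ε, hε, hb⟩ := Metric.isOpen_iff.1 hU f hf
  obtain ⟨s, hs⟩ := approx f hε
  refine ⟨_, hb (by rwa [Metric.mem_ball, dist_eq_norm]), s.sup Int.natAbs, ?_⟩
  intro n hn
  rw [sum_e_apply, if_neg]
  intro hns
  have h1 : n.natAbs ≤ s.sup Int.natAbs := Finset.le_sup hns
  have h2 : ((n.natAbs : ℕ) : ℝ) = |(n : ℝ)| := by
    rw [Nat.cast_natAbs]; push_cast; rfl
  rw [← h2] at hn
  exact absurd (Nat.cast_le.2 h1) (not_le.2 hn)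

/-- weighted shift by `s`, conjugate to the translation by `s` -/
noncomputable def Sh (d : ℤ → ℝ) (hd : ∀ i j : ℤ, d i - d j ≤ |(i : ℝ) - j|) (s : ℤ) (f : E) : E where
  toFun := fun j => Real.exp (d (j + s) - d j) * f (j + s)
  continuous_toFun := continuous_of_discreteTopology
  zero_at_infty' := by
    have h := f.zero_at_infty'
    rw [Filter.cocompact_eq_cofinite] at h ⊢
    have h1 : Tendsto (fun j : ℤ => f (j + s)) cofinite (𝓝 0) :=
      h.comp (add_left_injective s).tendsto_cofinite
    have h2 : Tendsto (fun j : ℤ => Real.exp |(s : ℝ)| * |f (j + s)|) cofinite (𝓝 0) := by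
      simpa using h1.abs.const_mul (Real.exp |(s : ℝ)|)
    refine squeeze_zero_norm (fun j => ?_) h2
    rw [Real.norm_eq_abs, abs_mul, Real.abs_exp]
    gcongr
    have := hd (j + s) j
    push_cast at this
    simpa using this

section
variable {d : ℤ → ℝ} (hd : ∀ i j : ℤ, d i - d j ≤ |(i : ℝ) - j|)

lemma Sh_apply (s : ℤ) (f : E) (j : ℤ) :
    Sh d hd s f j = Real.exp (d (j + s) - d j) * f (j + s) := rfl

lemma Sh_linear (s : ℤ) : IsLinearMap ℝ (Sh d hd s) where
  map_add f g := by
    ext j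
    simp only [Sh_apply, ZeroAtInftyContinuousMap.add_apply]; ring
  map_smul c f := by
    ext j
    simp only [Sh_apply, ZeroAtInftyContinuousMap.smul_apply, smul_eq_mul]; ring

lemma Sh_norm (s : ℤ) (f : E) : ‖Sh d hd s f‖ ≤ Real.exp |(s : ℝ)| * ‖f‖ := by
  rw [norm_le_iff' _ (by positivity)]
  intro j
  rw [Sh_apply, abs_mul, Real.abs_exp]
  have := hd (j + s) j
  push_cast at this
  simp only [add_sub_cancel_left] at this
  gcongr
  exact abs_le_norm f _

lemma Sh_cont (s : ℤ) : Continuous (Sh d hd s) :=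
  AddMonoidHomClass.continuous_of_bound ((Sh_linear hd s).mk') (Real.exp |(s : ℝ)|) (Sh_norm hd s)

lemma Sh_comp (s t : ℤ) (f : E) : Sh d hd s (Sh d hd t f) = Sh d hd (t + s) f := by
  ext j
  simp only [Sh_apply]
  rw [← mul_assoc, ← Real.exp_add, add_assoc, add_comm s t]
  congr 2
  ring

lemma Sh_zero (f : E) : Sh d hd 0 f = f := by
  ext j; simp [Sh_apply]

lemma Sh_iter (n : ℕ) (f : E) : (Sh d hd 1)^[n] f = Sh d hd n f := by
  induction n with
  | zero => simp [Sh_zero]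
  | succ n ih => rw [Function.iterate_succ_apply', ih, Sh_comp]; push_cast; rfl

lemma Sh_small (s : ℤ) (f : E) (m : ℕ) (hf : ∀ n : ℤ, (m : ℝ) < |(n : ℝ)| → f n = 0) :
    ‖Sh d hd s f‖ ≤ Real.exp (2 * m + d 0 - d (-s)) * ‖f‖ := by
  rw [norm_le_iff' _ (by positivity)]
  intro j
  rw [Sh_apply, abs_mul, Real.abs_exp]
  by_cases h : (m : ℝ) < |((j + s : ℤ) : ℝ)|
  · rw [hf _ h]; simp; positivity
  · have h1 := hd (j + s) 0
    have h2 := hd (-s) j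
    rw [abs_sub_comm] at h2
    push_cast at h h1 h2
    simp only [sub_neg_eq_add, sub_zero] at h1 h2
    refine mul_le_mul (Real.exp_le_exp.2 ?_) (abs_le_norm f _) (abs_nonneg _) (Real.exp_pos _).le
    linarith

/-- the bundled operator -/
noncomputable def op : FrechetOp where
  𝕜 := ℝ
  X := E
  infDim := infDimE
  T := Sh d hd 1
  linear := Sh_linear hd 1
  cont := Sh_cont hd 1

lemma op_inv : (op hd).Invertible := by
  refine ⟨Sh d hd (-1), Sh_cont hd _, fun x => ?_, fun x => ?_⟩
  · exact (Sh_comp hd (-1) 1 x).trans (Sh_zero hd x)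
  · exact (Sh_comp hd 1 (-1) x).trans (Sh_zero hd x)

lemma op_trans (F : Set (Set ℕ)) (hF : IsFamily F)
    (h : ∀ k : ℕ, {n : ℕ | (k : ℝ) ≤ d n ∧ (k : ℝ) ≤ d (-n)} ∈ F) : FTrans (Sh d hd 1) F := by
  intro U V hU hV hUn hVn
  obtain ⟨x, hx, m, hm⟩ := exists_supp hU hUn
  obtain ⟨y, hy, m', hm'⟩ := exists_supp hV hVn
  obtain ⟨ε, hε, hb⟩ := Metric.isOpen_iff.1 hU x hx
  obtain ⟨ε', hε', hb'⟩ := Metric.isOpen_iff.1 hV y hy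
  have key : ∀ (m : ℕ) (M ε : ℝ), 0 < ε →
      ∀ᶠ k : ℕ in atTop, Real.exp (2 * m + d 0 - k) * M < ε := by
    intro m M ε hε
    have h1 : Tendsto (fun k : ℕ => Real.exp (2 * m + d 0 - k) * M) atTop (𝓝 0) := by
      have : Tendsto (fun k : ℕ => Real.exp (2 * m + d 0 - k)) atTop (𝓝 0) := by
        refine Real.tendsto_exp_atBot.comp ?_
        simp only [sub_eq_add_neg]
        exact tendsto_atBot_add_const_left _ _
          (tendsto_neg_atTop_atBot.comp tendsto_natCast_atTop_atTop)
      simpa using this.mul_const M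
    exact h1.eventually_lt_const hε
  obtain ⟨k, hk, hk'⟩ := ((key m ‖x‖ ε' hε').and (key m' ‖y‖ ε hε)).exists
  refine hF.2.1 (h k) ?_
  rintro n ⟨hn1, hn2⟩
  refine ⟨x + Sh d hd (-n) y, hb ?_, hb' ?_⟩
  · rw [Metric.mem_ball, dist_eq_norm, add_sub_cancel_left]
    refine lt_of_le_of_lt (Sh_small hd (-n) y m' hm') (lt_of_le_of_lt ?_ hk')
    rw [neg_neg]
    gcongr
  · rw [Sh_iter, (Sh_linear hd n).map_add, Sh_comp, neg_add_cancel, Sh_zero, Metric.mem_ball,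
      dist_eq_norm, add_sub_cancel_right]
    refine lt_of_le_of_lt (Sh_small hd n x m hm) (lt_of_le_of_lt ?_ hk)
    gcongr

/-- test sets -/
def U0 : Set E := {f | ‖f‖ < 1 / 2}
/-- test sets -/
def V0 : Set E := {f | 1 / 2 < f 0}

lemma isOpen_U0 : IsOpen U0 := isOpen_lt continuous_norm continuous_const
lemma isOpen_V0 : IsOpen V0 := by
  rw [Metric.isOpen_iff]
  intro f hf
  refine ⟨f 0 - 1 / 2, sub_pos.2 hf, fun g hg => ?_⟩
  rw [Metric.mem_ball, dist_eq_norm] at hg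
  have h1 : |g 0 - f 0| ≤ ‖g - f‖ := abs_le_norm (g - f) 0
  have h2 := neg_abs_le (g 0 - f 0)
  change 1 / 2 < g 0
  linarith

lemma nonempty_U0 : U0.Nonempty := ⟨0, by simp [U0]⟩
lemma nonempty_V0 : V0.Nonempty := ⟨e 0, by simp [V0, e_apply]; norm_num⟩

lemma hit (hd0 : ∀ i, 0 ≤ d i) (n : ℕ) (hn : d n = 0) (f : E) (hf : f ∈ U0)
    (hf' : Sh d hd n f ∈ V0) : False := by
  have h1 : 1 / 2 < Real.exp (d (0 + n) - d 0) * f (0 + n) := hf'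
  have h2 : ‖f‖ < 1 / 2 := hf
  have h3 := abs_le_norm f n
  rw [zero_add, hn] at h1
  have h4 : Real.exp (0 - d 0) ≤ 1 := by
    rw [Real.exp_le_one_iff]; linarith [hd0 0]
  have h5 : Real.exp (0 - d 0) * f n ≤ 1 * |f n| := by
    exact (mul_le_mul_of_nonneg_left (le_abs_self (f n)) (Real.exp_pos _).le).trans
      (mul_le_mul_of_nonneg_right h4 (abs_nonneg _))
  linarith

end

section setdist

/-- distance to the symmetrized complement -/
noncomputable def dd (A : Set ℕ) (i : ℤ) : ℝ := Metric.infDist i {z : ℤ | z.natAbs ∉ A}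

lemma dd_lip (A : Set ℕ) (i j : ℤ) : dd A i - dd A j ≤ |(i : ℝ) - j| := by
  have : dd A i ≤ dd A j + dist i j := Metric.infDist_le_infDist_add_dist
  rw [Int.dist_eq] at this
  linarith

lemma dd_nonneg (A : Set ℕ) (i : ℤ) : 0 ≤ dd A i := Metric.infDist_nonneg

lemma dd_zero (A : Set ℕ) (n : ℕ) (hn : n ∉ A) : dd A n = 0 :=
  Metric.infDist_zero_of_mem (by simpa using hn)

lemma dd_mem {F : Set (Set ℕ)} (hF : IsFamily F) (hsi : ShiftInvariant F) (hth : ThickFamily F)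
    {A : Set ℕ} (hA : A ∈ F) (hne : ∃ a, a ∉ A) (k : ℕ) :
    {n : ℕ | (k : ℝ) ≤ dd A n ∧ (k : ℝ) ≤ dd A (-n)} ∈ F := by
  refine hF.2.1 (hsi _ (hth A hA (2 * k)) k) ?_
  rintro n ⟨p, hp, hpn⟩
  obtain ⟨a, ha⟩ := hne
  have hSne : {z : ℤ | z.natAbs ∉ A}.Nonempty := ⟨a, by simpa using ha⟩
  have main : ∀ z : ℤ, z.natAbs ∉ A → (k : ℤ) ≤ |(n : ℤ) - z| ∧ (k : ℤ) ≤ |-(n : ℤ) - z| := by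
    intro z hz
    have aux : ∀ i ≤ 2 * k, z.natAbs ≠ p + i := fun i hi h => hz (h ▸ hp i hi)
    by_contra hcon
    rw [le_abs, le_abs] at hcon
    apply aux (z.natAbs - p) <;> omega
  constructor
  · refine (Metric.le_infDist hSne).2 fun {z} hz => ?_
    rw [Int.dist_eq]
    exact_mod_cast (main z hz).1
  · refine (Metric.le_infDist hSne).2 fun {z} hz => ?_
    rw [Int.dist_eq]
    exact_mod_cast (main z hz).2

end setdist

lemma birkhoff {X : Type*} [TopologicalSpace X] [SecondCountableTopology X] [BaireSpace X]
    [Nonempty X] {T : X → X} (hT : Continuous T) (h : TopTrans T) : HypercyclicMap T := by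
  let b := TopologicalSpace.countableBasis X
  have hb := TopologicalSpace.isBasis_countableBasis X
  have hbc : b.Countable := TopologicalSpace.countable_countableBasis X
  have hbo : ∀ V ∈ b, IsOpen V := fun V hV => TopologicalSpace.isOpen_of_mem_countableBasis hV
  have hbn : ∀ V ∈ b, V.Nonempty := fun V hV => TopologicalSpace.nonempty_of_mem_countableBasis hV
  have hd : Dense (⋂ V ∈ b, ⋃ n : ℕ, T^[n] ⁻¹' V) := by
    refine dense_biInter_of_isOpen (fun V hV => isOpen_iUnion fun n =>
      (hbo V hV).preimage (hT.iterate n)) hbc (fun V hV => ?_)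
    rw [dense_iff_inter_open]
    intro U hU hUn
    obtain ⟨n, x, hx, hx'⟩ := h U V hU (hbo V hV) hUn (hbn V hV)
    exact ⟨x, hx, mem_iUnion.2 ⟨n, hx'⟩⟩
  obtain ⟨x, hx⟩ := hd.nonempty
  refine ⟨x, hb.dense_iff.2 fun V hV _ => ?_⟩
  obtain ⟨n, hn⟩ := mem_iUnion.1 (mem_iInter₂.1 hx V hV)
  exact ⟨_, hn, n, rfl⟩

lemma prod_iter {X Y : Type*} (T : X → X) (S : Y → Y) (n : ℕ) (p : X × Y) :
    (prodMap' T S)^[n] p = (T^[n] p.1, S^[n] p.2) := by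
  induction n with
  | zero => rfl
  | succ n ih => rw [iterate_succ_apply', ih, iterate_succ_apply', iterate_succ_apply']; rfl

lemma frechet_nice (T : FrechetOp) : (uniformity T.X).IsCountablyGenerated := by
  exact IsUniformAddGroup.uniformity_countably_generated

lemma wd_of_meet (T S : FrechetOp) (F₁ F₂ : Set (Set ℕ)) (hT : FTrans T.T F₁)
    (hS : FTrans S.T F₂) (h : ∀ A ∈ F₁, ∀ B ∈ F₂, (A ∩ B).Nonempty) :
    WeaklyDisjoint T.T S.T := by
  have := frechet_nice T
  have := frechet_nice S
  have : SecondCountableTopology T.X := UniformSpace.secondCountable_of_separable T.X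
  have : SecondCountableTopology S.X := UniformSpace.secondCountable_of_separable S.X
  refine birkhoff ((T.cont.comp continuous_fst).prodMk (S.cont.comp continuous_snd)) ?_
  rintro U V hU hV ⟨⟨x, y⟩, hxy⟩ ⟨⟨x', y'⟩, hxy'⟩
  obtain ⟨U₁, U₂, hU₁, hU₂, hx, hy, hUU⟩ := isOpen_prod_iff.1 hU x y hxy
  obtain ⟨V₁, V₂, hV₁, hV₂, hx', hy', hVV⟩ := isOpen_prod_iff.1 hV x' y' hxy'
  obtain ⟨n, ⟨a, ha, ha'⟩, ⟨c, hc, hc'⟩⟩ := h _ (hT U₁ V₁ hU₁ hV₁ ⟨x, hx⟩ ⟨x', hx'⟩) _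
    (hS U₂ V₂ hU₂ hV₂ ⟨y, hy⟩ ⟨y', hy'⟩)
  refine ⟨n, (a, c), hUU ⟨ha, hc⟩, ?_⟩
  rw [prod_iter]
  exact hVV ⟨ha', hc'⟩

lemma not_wd {d d' : ℤ → ℝ} (hd : ∀ i j : ℤ, d i - d j ≤ |(i : ℝ) - j|)
    (hd' : ∀ i j : ℤ, d' i - d' j ≤ |(i : ℝ) - j|) (h0 : ∀ i, 0 ≤ d i) (h0' : ∀ i, 0 ≤ d' i)
    (h : ∀ n : ℕ, d n = 0 ∨ d' n = 0) : ¬ WeaklyDisjoint (Sh d hd 1) (Sh d' hd' 1) := by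
  rintro ⟨p, hp⟩
  have : Nontrivial E := ⟨e 0, 0, fun hh => by
    have := congrArg (fun f : E => f 0) hh
    simp [e_apply] at this⟩
  have hpun : ∀ q : E × E, (𝓝[≠] q).NeBot := fun q => Module.punctured_nhds_neBot ℝ (E × E) q
  obtain ⟨_, ⟨hn1, hn2⟩, n, rfl⟩ := hp.inter_open_nonempty _ (isOpen_U0.prod isOpen_U0)
    (nonempty_U0.prod nonempty_U0)
  have hp2 := hp.sdiff_finite ((Set.finite_Iic n).image fun n => (prodMap' (Sh d hd 1) (Sh d' hd' 1))^[n] p)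
  obtain ⟨_, ⟨hm1, hm2⟩, ⟨m, rfl⟩, hm⟩ := hp2.inter_open_nonempty _ (isOpen_V0.prod isOpen_V0)
    (nonempty_V0.prod nonempty_V0)
  have hmn : n < m := by
    by_contra hc
    exact hm ⟨m, not_lt.1 hc, rfl⟩
  obtain ⟨r, rfl⟩ := Nat.exists_eq_add_of_lt hmn
  simp only at hn1 hn2 hm1 hm2
  rw [show n + r + 1 = (r + 1) + n by ring, iterate_add_apply, prod_iter] at hm1 hm2
  simp only [Sh_iter] at hm1 hm2
  rcases h (r + 1) with h | h
  · exact hit hd h0 _ h _ hn1 hm1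
  · exact hit hd' h0' _ h _ hn2 hm2

end WDProof

/-- Let `F₁`, `F₂` be shift-invariant thick Furstenberg families.
There exist an invertible `F₁`-transitive operator `T` and an invertible
`F₂`-transitive operator `S` which are not weakly disjoint iff there are `A ∈ F₁`
and `B ∈ F₂` with `A ∩ B = ∅`. -/
theorem exists_not_weaklyDisjoint_iff_disjoint_members
    (F₁ F₂ : Set (Set ℕ)) (h₁ : IsFamily F₁) (hsi₁ : ShiftInvariant F₁)
    (hth₁ : ThickFamily F₁) (h₂ : IsFamily F₂) (hsi₂ : ShiftInvariant F₂)
    (hth₂ : ThickFamily F₂) :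
    (∃ T S : FrechetOp, T.Invertible ∧ S.Invertible ∧ FTrans T.T F₁ ∧
        FTrans S.T F₂ ∧ ¬ WeaklyDisjoint T.T S.T) ↔
      ∃ A ∈ F₁, ∃ B ∈ F₂, A ∩ B = ∅ := by
  constructor
  · rintro ⟨T, S, -, -, hT, hS, hn⟩
    by_contra hcon
    push Not at hcon
    exact hn (WDProof.wd_of_meet T S F₁ F₂ hT hS hcon)
  · rintro ⟨A, hA, B, hB, hAB⟩
    have hne : ∀ a, a ∉ A ∨ a ∉ B := by
      intro a
      by_contra hc
      push Not at hc
      exact (Set.eq_empty_iff_forall_notMem.1 hAB a) hc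
    have hAn : ∃ a, a ∉ A := by
      by_contra hc
      push Not at hc
      have : B = ∅ := Set.eq_empty_iff_forall_notMem.2 fun b hb =>
        (hne b).elim (fun h => h (hc b)) (fun h => h hb)
      exact h₂.2.2 (this ▸ hB)
    have hBn : ∃ a, a ∉ B := by
      by_contra hc
      push Not at hc
      have : A = ∅ := Set.eq_empty_iff_forall_notMem.2 fun b hb =>
        (hne b).elim (fun h => h hb) (fun h => h (hc b))
      exact h₁.2.2 (this ▸ hA)
    exact ⟨WDProof.op (WDProof.dd_lip A), WDProof.op (WDProof.dd_lip B),
      WDProof.op_inv _, WDProof.op_inv _,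
      WDProof.op_trans (WDProof.dd_lip A) F₁ h₁ (WDProof.dd_mem h₁ hsi₁ hth₁ hA hAn),
      WDProof.op_trans (WDProof.dd_lip B) F₂ h₂ (WDProof.dd_mem h₂ hsi₂ hth₂ hB hBn),
      WDProof.not_wd (WDProof.dd_lip A) (WDProof.dd_lip B) (WDProof.dd_nonneg A) (WDProof.dd_nonneg B)
        (fun n => (hne n).imp (WDProof.dd_zero A n) (WDProof.dd_zero B n))⟩
end

section
/- Let F₁ and F₂ be shift-invariant thick Furstenberg families, and suppose there exist F₁ ∈ F₁ and F₂ ∈ F₂ with F₁ ∩ F₂ = ∅. Then there exists an invertible operator T on the complex Hilbert space ℓ²(ℤ) such that T is F₁-transitive and its Hilbert-space adjoint T* is F₂-transitive. -/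
open Set Topology Function Filter
open scoped ENNReal

section Helpers

local notation "H" => lp (fun _ : ℤ => ℂ) 2

lemma wsh_summable (x : H) : Summable fun n : ℤ => ‖x n‖ ^ 2 := by
  have h := lp.memℓp x
  rw [memℓp_gen_iff (by norm_num)] at h
  simpa using h

lemma wsh_norm_sq (x : H) : ‖x‖ ^ 2 = ∑' n : ℤ, ‖x n‖ ^ 2 := by
  have h := lp.norm_rpow_eq_tsum (p := 2) (by norm_num) x
  simpa using h

lemma wsh_bound (c : ℤ → ℝ) (C : ℝ) (hc : ∀ n, |c n| ≤ C) (s : ℤ) (x : H) (n : ℤ) :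
    ‖(c n : ℂ) * x (n + s)‖ ^ 2 ≤ C ^ 2 * ‖x (n + s)‖ ^ 2 := by
  rw [norm_mul, mul_pow]
  have h : ‖(c n : ℂ)‖ ≤ C := by simpa using hc n
  gcongr

lemma wsh_summable_shift (C : ℝ) (s : ℤ) (x : H) :
    Summable fun n : ℤ => C ^ 2 * ‖x (n + s)‖ ^ 2 :=
  (((Equiv.addRight s).summable_iff (f := fun n : ℤ => ‖x n‖ ^ 2)).2 (wsh_summable x)).mul_left _

lemma wsh_mem (c : ℤ → ℝ) (C : ℝ) (hc : ∀ n, |c n| ≤ C) (s : ℤ) (x : H) :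
    Memℓp (E := fun _ : ℤ => ℂ) (fun n : ℤ => (c n : ℂ) * x (n + s)) 2 := by
  rw [memℓp_gen_iff (by norm_num)]
  have : Summable fun n : ℤ => ‖(c n : ℂ) * x (n + s)‖ ^ 2 :=
    Summable.of_nonneg_of_le (fun n => by positivity) (wsh_bound c C hc s x)
      (wsh_summable_shift C s x)
  simpa using this

/-- weighted shift -/
noncomputable def wsh (c : ℤ → ℝ) (C : ℝ) (hc : ∀ n, |c n| ≤ C) (s : ℤ) : H →L[ℂ] H :=
  LinearMap.mkContinuous
    { toFun := fun x => (⟨fun n : ℤ => (c n : ℂ) * x (n + s), wsh_mem c C hc s x⟩ : H)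
      map_add' := by
        intro x y
        ext n
        simp [mul_add]
        rfl
      map_smul' := by
        intro a x
        ext n
        simp
        ring } C (by
    intro x
    have hC : 0 ≤ C := (abs_nonneg _).trans (hc 0)
    refine le_of_sq_le_sq ?_ (by positivity) 
    rw [wsh_norm_sq, mul_pow, wsh_norm_sq x,
      ← (Equiv.addRight s).tsum_eq (fun n : ℤ => ‖x n‖ ^ 2), ← tsum_mul_left]
    refine Summable.tsum_le_tsum (fun n => wsh_bound c C hc s x n) ?_ (wsh_summable_shift C s x)
    exact Summable.of_nonneg_of_le (fun n => by positivity) (wsh_bound c C hc s x)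
      (wsh_summable_shift C s x))

lemma wsh_apply (c : ℤ → ℝ) (C : ℝ) (hc : ∀ n, |c n| ≤ C) (s : ℤ) (x : H) (n : ℤ) :
    wsh c C hc s x n = (c n : ℂ) * x (n + s) := rfl

/-- good times -/
def goodT (φ : ℤ → ℝ) (K : ℝ) (J : ℤ) : Set ℕ :=
  {k | ∀ j : ℤ, |j| ≤ J → K ≤ φ (k + j) ∧ K ≤ φ (-k + j)}

lemma wsh_single (φ : ℤ → ℝ) (s : ℤ) (T : H →L[ℂ] H)
    (hT : ∀ x n, T x n = (Real.exp (φ (n + s) - φ n) : ℂ) * x (n + s)) (k : ℕ) (m : ℤ) (a : ℂ) :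
    T^[k] (lp.single 2 m a) =
      lp.single 2 (m - k * s) ((Real.exp (φ m - φ (m - k * s)) : ℂ) * a) := by
  induction k with
  | zero => simp
  | succ k ih =>
    rw [Function.iterate_succ_apply', ih]
    ext n
    rw [hT]
    have e : m - ((k + 1 : ℕ) : ℤ) * s = m - k * s - s := by push_cast; ring
    rw [e]
    simp only [lp.single_apply, Pi.single_apply]
    by_cases h : n + s = m - k * s
    · have h' : n = m - k * s - s := by linarith
      rw [if_pos h, if_pos h', h, ← mul_assoc, ← Complex.ofReal_mul, ← Real.exp_add, h']
      congr 3
      ring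
    · have h' : ¬ n = m - k * s - s := fun h' => h (by linarith)
      rw [if_neg h, if_neg h', mul_zero]

lemma wsh_small_single (φ : ℤ → ℝ) (s : ℤ) (hs : s = 1 ∨ s = -1) (T : H →L[ℂ] H)
    (hT : ∀ x n, T x n = (Real.exp (φ (n + s) - φ n) : ℂ) * x (n + s)) (m : ℤ) (a : ℂ)
    (ε : ℝ) (hε : 0 < ε) :
    ∃ K : ℝ, ∃ J : ℤ, ∀ k ∈ goodT φ K J, ‖T^[k] (lp.single 2 m a)‖ < ε := by
  have hlim : Tendsto (fun K : ℝ => Real.exp (φ m - K) * ‖a‖) atTop (𝓝 (0 * ‖a‖)) := by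
    refine Tendsto.mul_const _ (Real.tendsto_exp_atBot.comp ?_)
    exact tendsto_atBot_add_const_left _ _ tendsto_neg_atTop_atBot
  rw [zero_mul] at hlim
  obtain ⟨K, hK⟩ := (hlim.eventually (gt_mem_nhds hε)).exists
  refine ⟨K, |m|, fun k hk => ?_⟩
  have hk' := hk m le_rfl
  have hle : K ≤ φ (m - k * s) := by
    rcases hs with rfl | rfl
    · convert hk'.2 using 2; ring
    · convert hk'.1 using 2; ring
  rw [wsh_single φ s T hT, lp.norm_single (by norm_num), norm_mul, Complex.norm_real,
    Real.norm_eq_abs, abs_of_pos (Real.exp_pos _)]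
  refine lt_of_le_of_lt ?_ hK
  gcongr

lemma wsh_small (φ : ℤ → ℝ) (s : ℤ) (hs : s = 1 ∨ s = -1) (T : H →L[ℂ] H)
    (hT : ∀ x n, T x n = (Real.exp (φ (n + s) - φ n) : ℂ) * x (n + s)) (t : Finset ℤ)
    (a : ℤ → ℂ) : ∀ ε : ℝ, 0 < ε → 
    ∃ K : ℝ, ∃ J : ℤ, ∀ k ∈ goodT φ K J, ‖T^[k] (∑ m ∈ t, lp.single 2 m (a m) : H)‖ < ε := by
  classical
  induction t using Finset.induction_on with
  | empty =>
    intro ε hε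
    refine ⟨0, 0, fun k _ => ?_⟩
    rw [Finset.sum_empty, iterate_map_zero, norm_zero]
    exact hε
  | insert m t hm ih =>
    intro ε hε
    obtain ⟨K₁, J₁, h₁⟩ := ih (ε / 2) (half_pos hε)
    obtain ⟨K₂, J₂, h₂⟩ := wsh_small_single φ s hs T hT m (a m) (ε / 2) (half_pos hε)
    refine ⟨max K₁ K₂, max J₁ J₂, fun k hk => ?_⟩
    have g₁ := h₁ k fun j hj =>
      ⟨(le_max_left _ _).trans (hk j (hj.trans (le_max_left _ _))).1,
        (le_max_left _ _).trans (hk j (hj.trans (le_max_left _ _))).2⟩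
    have g₂ := h₂ k fun j hj =>
      ⟨(le_max_right _ _).trans (hk j (hj.trans (le_max_right _ _))).1,
        (le_max_right _ _).trans (hk j (hj.trans (le_max_right _ _))).2⟩
    rw [Finset.sum_insert hm, iterate_map_add]
    refine (norm_add_le _ _).trans_lt ?_
    linarith

lemma exists_fin (U : Set H) (hU : IsOpen U) (hne : U.Nonempty) :
    ∃ t : Finset ℤ, ∃ a : ℤ → ℂ, (∑ m ∈ t, lp.single 2 m (a m) : H) ∈ U := by
  obtain ⟨x, hx⟩ := hne
  have h := lp.hasSum_single (p := 2) (by norm_num) x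
  obtain ⟨t, ht⟩ := (h.eventually (hU.mem_nhds hx)).exists
  exact ⟨t, x, ht⟩

lemma wsh_trans (F : Set (Set ℕ)) (hF : IsFamily F) (φ : ℤ → ℝ)
    (hφ : ∀ K J, goodT φ K J ∈ F) (s : ℤ) (hs : s = 1 ∨ s = -1) (T T' : H →L[ℂ] H)
    (hT : ∀ x n, T x n = (Real.exp (φ (n + s) - φ n) : ℂ) * x (n + s))
    (hT' : ∀ x n, T' x n = (Real.exp (φ (n + -s) - φ n) : ℂ) * x (n + -s))
    (hinv : ∀ x, T (T' x) = x) : FTrans ⇑T F := by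
  intro U V hU hV hUn hVn
  obtain ⟨t, a, hx⟩ := exists_fin U hU hUn
  obtain ⟨u, b, hy⟩ := exists_fin V hV hVn
  obtain ⟨ε₁, hε₁, hb₁⟩ := Metric.isOpen_iff.1 hU _ hx
  obtain ⟨ε₂, hε₂, hb₂⟩ := Metric.isOpen_iff.1 hV _ hy
  obtain ⟨K₁, J₁, h₁⟩ := wsh_small φ s hs T hT t a ε₂ hε₂
  obtain ⟨K₂, J₂, h₂⟩ := wsh_small φ (-s) (by rcases hs with rfl | rfl <;> simp) T' hT' u b ε₁ hε₁
  refine hF.2.1 (hφ (max K₁ K₂) (max J₁ J₂)) fun k hk => ?_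
  have g₁ := h₁ k fun j hj =>
    ⟨(le_max_left _ _).trans (hk j (hj.trans (le_max_left _ _))).1,
      (le_max_left _ _).trans (hk j (hj.trans (le_max_left _ _))).2⟩
  have g₂ := h₂ k fun j hj =>
    ⟨(le_max_right _ _).trans (hk j (hj.trans (le_max_right _ _))).1,
      (le_max_right _ _).trans (hk j (hj.trans (le_max_right _ _))).2⟩
  refine ⟨(∑ m ∈ t, lp.single 2 m (a m) : H) + T'^[k] (∑ m ∈ u, lp.single 2 m (b m) : H),
    hb₁ ?_, hb₂ ?_⟩
  · rw [Metric.mem_ball, dist_eq_norm, add_sub_cancel_left]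
    exact g₂
  · rw [Metric.mem_ball, dist_eq_norm, iterate_map_add,
      (show Function.LeftInverse T T' from hinv).iterate k, add_sub_cancel_right]
    exact g₁

/-- symmetric integer copy -/
def symm' (A : Set ℕ) : Set ℤ := {n | n.natAbs ∈ A}

/-- potential -/
noncomputable def pot (A B : Set ℕ) (n : ℤ) : ℝ :=
  Metric.infDist n (symm' A)ᶜ - Metric.infDist n (symm' B)ᶜ

lemma pot_lip (A B : Set ℕ) (n m : ℤ) (h : |n - m| ≤ 1) : pot A B n - pot A B m ≤ 2 := by
  have h1 := Metric.infDist_le_infDist_add_dist (s := (symm' A)ᶜ) (x := n) (y := m)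
  have h2 := Metric.infDist_le_infDist_add_dist (s := (symm' B)ᶜ) (x := m) (y := n)
  have h3 : dist n m ≤ 1 := by
    rw [Int.dist_eq]; exact_mod_cast h
  rw [dist_comm m n] at h2
  unfold pot
  linarith

lemma pot_good (F : Set (Set ℕ)) (hF : IsFamily F) (hsi : ShiftInvariant F)
    (hth : ThickFamily F) (A B : Set ℕ) (hA : A ∈ F) (hB : B.Nonempty) (hAB : A ∩ B = ∅)
    (K : ℝ) (J : ℤ) : goodT (pot A B) K J ∈ F := by
  obtain ⟨L, hL⟩ := exists_nat_ge K
  set N : ℕ := L + J.natAbs with hN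
  refine hF.2.1 (hsi _ (hth A hA (2 * N)) N) ?_
  rintro k ⟨m, hm, hk⟩
  have hk : k = m + N := by omega
  have hdisj : ∀ a, a ∈ A → a ∉ B := fun a h1 h2 => by
    have : a ∈ A ∩ B := ⟨h1, h2⟩
    simp [hAB] at this
  have hmem : ∀ z : ℤ, |z.natAbs - (k : ℤ)| ≤ N → z ∈ symm' A := by
    intro z hz
    have := hm (z.natAbs - m) (by rw [abs_le] at hz; omega)
    rw [abs_le] at hz
    rwa [show m + (z.natAbs - m) = z.natAbs by omega] at this
  have key : ∀ z : ℤ, |z.natAbs - (k : ℤ)| ≤ J.natAbs → K ≤ pot A B z := by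
    intro z hz
    have hzA : z ∈ symm' A := hmem z (by omega)
    have h0 : Metric.infDist z (symm' B)ᶜ = 0 :=
      Metric.infDist_zero_of_mem (fun h => hdisj _ hzA h)
    unfold pot
    rw [h0, sub_zero]
    refine hL.trans ?_
    obtain ⟨b, hb⟩ := hB
    have hne : ((symm' A)ᶜ).Nonempty := ⟨(b : ℤ), fun h => hdisj b (by simpa [symm'] using h) hb⟩
    rw [Metric.le_infDist hne]
    intro y hy
    by_contra hlt
    rw [not_le, Int.dist_eq] at hlt
    have hlt' : |z - y| < (L : ℤ) := by exact_mod_cast hlt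
    apply hy
    apply hmem
    rw [abs_le] at hz ⊢
    rw [abs_lt] at hlt'
    omega
  intro j hj
  rw [abs_le] at hj
  exact ⟨key _ (by rw [abs_le]; omega), key _ (by rw [abs_le]; omega)⟩

lemma pot_neg (A B : Set ℕ) (n : ℤ) : -pot A B n = pot B A n := by
  unfold pot; ring

lemma exp_pot_bound (A B : Set ℕ) (s : ℤ) (hs : |s| ≤ 1) (n : ℤ) :
    |Real.exp (pot A B (n + s) - pot A B n)| ≤ Real.exp 2 := by
  rw [abs_of_pos (Real.exp_pos _)]
  exact Real.exp_le_exp.2 (pot_lip A B _ _ (by simpa using hs))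

/-- the operators -/
noncomputable def opS (A B : Set ℕ) (s : ℤ) (hs : |s| ≤ 1) : H →L[ℂ] H :=
  wsh (fun n => Real.exp (pot A B (n + s) - pot A B n)) (Real.exp 2) (exp_pot_bound A B s hs) s

lemma opS_apply (A B : Set ℕ) (s : ℤ) (hs : |s| ≤ 1) (x : H) (n : ℤ) :
    opS A B s hs x n = (Real.exp (pot A B (n + s) - pot A B n) : ℂ) * x (n + s) := rfl

lemma opS_inv (A B : Set ℕ) (s s' : ℤ) (hs : |s| ≤ 1) (hs' : |s'| ≤ 1) (h : s + s' = 0) (x : H) :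
    opS A B s hs (opS A B s' hs' x) = x := by
  ext n
  rw [opS_apply, opS_apply, add_assoc, h, add_zero, ← mul_assoc, ← Complex.ofReal_mul,
    ← Real.exp_add]
  simp

lemma opS_adj (A B : Set ℕ) (s s' : ℤ) (hs : |s| ≤ 1) (hs' : |s'| ≤ 1) (h : s + s' = 0) :
    opS B A s' hs' = ContinuousLinearMap.adjoint (opS A B s hs) := by
  rw [ContinuousLinearMap.eq_adjoint_iff]
  intro x y
  rw [lp.inner_eq_tsum, lp.inner_eq_tsum,
    ← (Equiv.addRight s).tsum_eq (fun n : ℤ => inner ℂ (opS B A s' hs' x n) (y n))]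
  refine tsum_congr fun n => ?_
  simp only [Equiv.coe_addRight]
  rw [opS_apply, opS_apply, add_assoc, h, add_zero, ← pot_neg A B, ← pot_neg A B]
  simp only [RCLike.inner_apply, map_mul, Complex.conj_ofReal]
  rw [show -pot A B n - -pot A B (n + s) = pot A B (n + s) - pot A B n by ring]
  ring

end Helpers

/-- Let `F₁`, `F₂` be shift-invariant thick Furstenberg families
containing disjoint members. Then there is an invertible operator `T` on the complex
Hilbert space `ℓ²(ℤ)` such that `T` is `F₁`-transitive and its adjoint `T*` is
`F₂`-transitive. -/
theorem exists_invertible_op_l2Z_transitive_with_adjoint_transitive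
    (F₁ F₂ : Set (Set ℕ)) (h₁ : IsFamily F₁) (hsi₁ : ShiftInvariant F₁)
    (hth₁ : ThickFamily F₁) (h₂ : IsFamily F₂) (hsi₂ : ShiftInvariant F₂)
    (hth₂ : ThickFamily F₂)
    (hdisj : ∃ A ∈ F₁, ∃ B ∈ F₂, A ∩ B = ∅) :
    ∃ T : lp (fun _ : ℤ => ℂ) 2 →L[ℂ] lp (fun _ : ℤ => ℂ) 2,
      (∃ T' : lp (fun _ : ℤ => ℂ) 2 →L[ℂ] lp (fun _ : ℤ => ℂ) 2,
        (∀ x, T' (T x) = x) ∧ (∀ x, T (T' x) = x)) ∧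
      FTrans ⇑T F₁ ∧ FTrans ⇑(ContinuousLinearMap.adjoint T) F₂ := by
  obtain ⟨A, hA, B, hB, hAB⟩ := hdisj
  have nA : A.Nonempty := by
    rw [Set.nonempty_iff_ne_empty]; rintro rfl; exact h₁.2.2 hA
  have nB : B.Nonempty := by
    rw [Set.nonempty_iff_ne_empty]; rintro rfl; exact h₂.2.2 hB
  have e1 : |(1 : ℤ)| ≤ 1 := by norm_num
  have e2 : |(-1 : ℤ)| ≤ 1 := by norm_num
  refine ⟨opS A B 1 e1, ⟨opS A B (-1) e2, fun x => opS_inv A B _ _ _ _ (by norm_num) x,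
    fun x => opS_inv A B _ _ _ _ (by norm_num) x⟩, ?_, ?_⟩
  · exact wsh_trans F₁ h₁ (pot A B) (pot_good F₁ h₁ hsi₁ hth₁ A B hA nB hAB) 1 (Or.inl rfl)
      _ (opS A B (-1) e2) (opS_apply A B 1 e1) (opS_apply A B (-1) e2)
      (fun x => opS_inv A B _ _ _ _ (by norm_num) x)
  · rw [← opS_adj A B 1 (-1) e1 e2 (by norm_num)]
    exact wsh_trans F₂ h₂ (pot B A) (pot_good F₂ h₂ hsi₂ hth₂ B A hB nA
        (by rw [Set.inter_comm]; exact hAB)) (-1) (Or.inr rfl)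
      _ (opS B A 1 e1) (opS_apply B A (-1) e2) (by simpa using opS_apply B A 1 e1)
      (fun x => opS_inv B A _ _ _ _ (by norm_num) x)
end
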